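/- For every n ≥ 3, the spherical cover number σ²₃(K_n) of the complete graph K_n satisfies ⌊(n+7)/6⌋ ≤ σ²₃(K_n) ≤ ⌈n/4⌉; that is, K_n admits a crossing-free circular-arc drawing in ℝ³ whose arcs are contained in the union of ⌈n/4⌉ spheres, and no crossing-free circular-arc drawing of K_n in ℝ³ is contained in the union of fewer than ⌊(n+7)/6⌋ spheres. -/

import Mathlib

open Set

noncomputable section

/-- An `l`-dimensional sphere in `ℝ^d`: the set of points of an `(l+1)`-dimensional affine
subspace `P` of `ℝ^d` at a fixed positive distance `r` from a center `c ∈ P`. -/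
def IsSphereDim (d l : ℕ) (S : Set (EuclideanSpace ℝ (Fin d))) : Prop :=
  ∃ (P : AffineSubspace ℝ (EuclideanSpace ℝ (Fin d))) (c : EuclideanSpace ℝ (Fin d)) (r : ℝ),
    Module.finrank ℝ P.direction = l + 1 ∧ c ∈ P ∧ 0 < r ∧
    S = {x | x ∈ P ∧ dist x c = r}

/-- A circle in `ℝ^d` is a 1-dimensional sphere. -/
def IsCircle (d : ℕ) (S : Set (EuclideanSpace ℝ (Fin d))) : Prop :=
  IsSphereDim d 1 S

/-- An arc in `ℝ^d`: a nonempty compact connected subset of a circle. -/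
def IsArc (d : ℕ) (A : Set (EuclideanSpace ℝ (Fin d))) : Prop :=
  ∃ C, IsCircle d C ∧ A ⊆ C ∧ IsCompact A ∧ IsConnected A

/-- A crossing-free circular-arc drawing of a simple graph `G` in `ℝ^d`:
vertices are mapped injectively to points, every edge `e = uv` is represented by an arc
`arc e` containing the images of `u` and `v`, the arcs of two distinct edges intersect
exactly in the images of the common endpoints of those edges, and the image of a vertex `w`
lies on the arc of an edge `e` only if `w` is an endpoint of `e`. -/
structure CircularArcDrawing (d : ℕ) {V : Type*} (G : SimpleGraph V) where
  pos : V → EuclideanSpace ℝ (Fin d)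
  inj : Function.Injective pos
  arc : Sym2 V → Set (EuclideanSpace ℝ (Fin d))
  arc_isArc : ∀ e ∈ G.edgeSet, IsArc d (arc e)
  endpoint_mem : ∀ e ∈ G.edgeSet, ∀ v ∈ e, pos v ∈ arc e
  crossFree : ∀ e ∈ G.edgeSet, ∀ f ∈ G.edgeSet, e ≠ f →
    arc e ∩ arc f = pos '' {w | w ∈ e ∧ w ∈ f}
  vertex_mem : ∀ e ∈ G.edgeSet, ∀ w, pos w ∈ arc e → w ∈ e

/-- The drawing `D` is covered by the family `𝒞` of sets:
every arc of `D` is contained in some member of `𝒞`. -/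
def CircularArcDrawing.CoveredBy {d : ℕ} {V : Type*} {G : SimpleGraph V}
    (D : CircularArcDrawing d G) (𝒞 : Finset (Set (EuclideanSpace ℝ (Fin d)))) : Prop :=
  ∀ e ∈ G.edgeSet, ∃ C ∈ 𝒞, D.arc e ⊆ C

/-- All arcs of the drawing `D` are contained in the union of the family `𝒮` of
2-dimensional spheres in `ℝ³`. -/
def CircularArcDrawing.ArcsInSpheres {V : Type*} {G : SimpleGraph V}
    (D : CircularArcDrawing 3 G) (𝒮 : Finset (Set (EuclideanSpace ℝ (Fin 3)))) : Prop :=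
  (∀ S ∈ 𝒮, IsSphereDim 3 2 S) ∧ ∀ e ∈ G.edgeSet, D.arc e ⊆ ⋃ S ∈ 𝒮, S


namespace SC
open Complex Topology Filter

/-- Möbius map sending `b` to `0`, `a` to infinity (junk value `0` at `a`). -/
def fM (a b c p : ℂ) : ℂ := c * (p - b) / (p - a)

/-- Inverse of `fM`. -/
def gM (a b c w : ℂ) : ℂ := (c * b - w * a) / (c - w)

/-- Closed circular arc from `a` to `b`. -/
def Arc (a b c : ℂ) : Set ℂ := {p | fM a b c p ∉ slitPlane}

theorem mem_Arc {a b c p : ℂ} : p ∈ Arc a b c ↔ fM a b c p ∉ slitPlane := Iff.rfl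

theorem fM_left (a b c : ℂ) : fM a b c a = 0 := by simp [fM]

theorem fM_right (a b c : ℂ) : fM a b c b = 0 := by simp [fM]

theorem left_mem (a b c : ℂ) : a ∈ Arc a b c := by
  rw [mem_Arc, fM_left]; exact zero_notMem_slitPlane

theorem right_mem (a b c : ℂ) : b ∈ Arc a b c := by
  rw [mem_Arc, fM_right]; exact zero_notMem_slitPlane

theorem fM_continuousAt {a b c p : ℂ} (h : p ≠ a) : ContinuousAt (fM a b c) p := by
  have : p - a ≠ 0 := sub_ne_zero.2 h
  unfold fM
  fun_prop (disch := assumption)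

theorem gM_continuousAt {a b c w : ℂ} (h : w ≠ c) : ContinuousAt (gM a b c) w := by
  have : c - w ≠ 0 := sub_ne_zero.2 h.symm
  unfold gM
  fun_prop (disch := assumption)

theorem ne_of_notMem {a b c p : ℂ} (h : p ∉ Arc a b c) : p ≠ a := by
  rintro rfl; exact h (left_mem _ _ _)

theorem isClosed_Arc (a b c : ℂ) : IsClosed (Arc a b c) := by
  rw [← isOpen_compl_iff, isOpen_iff_mem_nhds]
  intro p hp
  have hp' : p ∉ Arc a b c := hp
  have h1 := fM_continuousAt (b := b) (c := c) (ne_of_notMem hp')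
  rw [mem_Arc, not_not] at hp'
  filter_upwards [h1.eventually (isOpen_slitPlane.mem_nhds hp')] with q hq
  exact fun h => h hq

section

theorem gM_sub {a b c : ℂ} {w : ℂ} (hw : w ≠ c) : gM a b c w - a = c * (b - a) / (c - w) := by
  have : c - w ≠ 0 := sub_ne_zero.2 hw.symm
  unfold gM; field_simp; ring

theorem gM_ne {a b c : ℂ} (hab : a ≠ b) (hc : c ∈ slitPlane) {w : ℂ} (hw : w ≠ c) : gM a b c w ≠ a := by
  have h1 : c - w ≠ 0 := sub_ne_zero.2 hw.symm
  have h2 : b - a ≠ 0 := sub_ne_zero.2 hab.symm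
  rw [← sub_ne_zero, gM_sub hw]
  exact div_ne_zero (mul_ne_zero (slitPlane_ne_zero hc) h2) h1

theorem fM_gM {a b c : ℂ} (hab : a ≠ b) (hc : c ∈ slitPlane) {w : ℂ} (hw : w ≠ c) : fM a b c (gM a b c w) = w := by
  have h1 : c - w ≠ 0 := sub_ne_zero.2 hw.symm
  have h2 : b - a ≠ 0 := sub_ne_zero.2 hab.symm
  have h3 := slitPlane_ne_zero hc
  have h4 : gM a b c w - b = w * (b - a) / (c - w) := by
    unfold gM; field_simp; ring
  unfold fM
  rw [gM_sub hw, h4]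
  field_simp

theorem gM_fM {a b c : ℂ} (hab : a ≠ b) (hc : c ∈ slitPlane) {p : ℂ} (hp : p ≠ a) : gM a b c (fM a b c p) = p := by
  have h1 : p - a ≠ 0 := sub_ne_zero.2 hp
  have h2 : b - a ≠ 0 := sub_ne_zero.2 hab.symm
  have h3 := slitPlane_ne_zero hc
  have h4 : c - c * (p - b) / (p - a) = c * (b - a) / (p - a) := by field_simp; ring
  unfold gM fM
  rw [h4]; field_simp; ring

theorem neg_ne {c : ℂ} (hc : c ∈ slitPlane) {y : ℝ} (hy : y ≤ 0) : (y : ℂ) ≠ c := by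
  rintro rfl
  rw [ofReal_mem_slitPlane] at hc; linarith

theorem gM_neg_mem {a b c : ℂ} (hab : a ≠ b) (hc : c ∈ slitPlane) {y : ℝ} (hy : y ≤ 0) : gM a b c y ∈ Arc a b c := by
  rw [mem_Arc, fM_gM hab hc (neg_ne hc hy), ofReal_mem_slitPlane]; linarith

theorem gM_neg_ne_right {a b c : ℂ} (hab : a ≠ b) (hc : c ∈ slitPlane) {y : ℝ} (hy : y < 0) : gM a b c y ≠ b := by
  intro h
  have h1 := fM_gM hab hc (neg_ne hc hy.le)
  rw [h, fM_right] at h1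
  have : (0:ℝ) = y := by exact_mod_cast h1
  linarith

theorem mem_Arc_cases {a b c : ℂ} (hab : a ≠ b) (hc : c ∈ slitPlane) {p : ℂ} (hp : p ∈ Arc a b c) :
    p = a ∨ p = b ∨ ∃ y : ℝ, y < 0 ∧ p = gM a b c y := by
  by_cases h : p = a
  · exact Or.inl h
  right
  rw [mem_Arc, mem_slitPlane_iff] at hp
  push Not at hp
  obtain ⟨h1, h2⟩ := hp
  have h3 : fM a b c p = ((fM a b c p).re : ℂ) := by
    apply Complex.ext <;> simp [h2]
  rcases h1.lt_or_eq with h4 | h4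
  · right
    refine ⟨_, h4, ?_⟩
    rw [← h3, gM_fM hab hc h]
  · left
    rw [h4] at h3
    have := gM_fM hab hc h
    rw [h3] at this
    rw [← this]
    have h5 := slitPlane_ne_zero hc
    simp [gM, h5]

end

theorem inv_slit_iff (z : ℂ) : z ∈ slitPlane ↔ z⁻¹ ∈ slitPlane := by
  by_cases hz : z = 0
  · simp [hz]
  have hn : 0 < normSq z := normSq_pos.2 hz
  rw [mem_slitPlane_iff, mem_slitPlane_iff, inv_re, inv_im]
  have : (-z.im / normSq z ≠ 0) ↔ z.im ≠ 0 := by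
    simp [div_eq_zero_iff, hn.ne']
  rw [this, div_pos_iff_of_pos_right hn]

theorem Arc_swap {a b c : ℂ} : Arc a b c = Arc b a c⁻¹ := by
  ext p
  have h : fM b a c⁻¹ p = (fM a b c p)⁻¹ := by
    unfold fM; rw [inv_div, mul_comm c, div_mul_eq_div_div, mul_comm c⁻¹]; ring
  rw [mem_Arc, mem_Arc, h, ← inv_slit_iff]

/-- Sides of an arc. -/
theorem side {a b c : ℂ} (hab : a ≠ b) (hc : c ∈ slitPlane) {Ω : Set ℂ}
    (h : ∀ y : ℝ, y < 0 → ∀ᶠ p in 𝓝 (gM a b c y), p ∉ Arc a b c → p ∈ Ω)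
    (σ : ℝ) (hσ : σ ≠ 0) :
    ∃ x ∈ Ω, ∀ y : ℝ, y < 0 → ∀ᶠ w in 𝓝 (y : ℂ), 0 < σ * w.im →
      gM a b c w ∈ connectedComponentIn Ω x := by
  have h1 : ∀ y : ℝ, y < 0 → ∃ ε > 0, ∀ w ∈ Metric.ball (y : ℂ) ε, w ≠ c ∧
      (0 < σ * w.im → gM a b c w ∈ Ω) := by
    intro y hy
    have hyc := neg_ne hc hy.le
    have := ((gM_continuousAt (a := a) (b := b) hyc).eventually (h y hy)).and
      (isOpen_ne.mem_nhds hyc)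
    obtain ⟨ε, hε, hb⟩ := Metric.eventually_nhds_iff_ball.1 this
    refine ⟨ε, hε, fun w hw => ⟨(hb w hw).2, fun hi => (hb w hw).1 ?_⟩⟩
    rw [mem_Arc, not_not, fM_gM hab hc (hb w hw).2, mem_slitPlane_iff]
    right
    intro h0; simp [h0] at hi
  have hpt : ∀ (y : ℝ) (ε : ℝ), 0 < ε → ∃ w ∈ Metric.ball (y : ℂ) ε, 0 < σ * w.im := by
    intro y ε hε
    refine ⟨y + ((ε / 2 / |σ| * σ : ℝ) : ℂ) * I, ?_, ?_⟩
    · have : 0 < |σ| := abs_pos.2 hσ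
      rw [Metric.mem_ball, dist_eq, add_sub_cancel_left, norm_mul, norm_I, norm_real,
        Real.norm_eq_abs, abs_mul, abs_div, abs_div, abs_abs]
      field_simp
      rw [abs_of_pos hε]; norm_num; linarith
    · have : 0 < |σ| := abs_pos.2 hσ
      simp only [add_im, ofReal_im, mul_im, ofReal_re, I_im, I_re]
      have : 0 < σ * σ := mul_self_pos.2 hσ
      have : 0 < ε / 2 / |σ| * (σ * σ) := by positivity
      nlinarith
  have hconv : ∀ (y ε : ℝ), IsPreconnected (Metric.ball (y : ℂ) ε ∩ {w | 0 < σ * w.im}) := by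
    intro y ε
    apply Convex.isPreconnected
    apply (convex_ball _ _).inter
    intro u hu v hv s t hs ht hst
    have hu' : 0 < σ * u.im := hu
    have hv' : 0 < σ * v.im := hv
    show 0 < σ * (s • u + t • v).im
    simp only [add_im, smul_im, smul_eq_mul]
    rcases hs.lt_or_eq with h | h
    · nlinarith [mul_pos h hu', mul_nonneg ht hv'.le]
    · subst h; have : t = 1 := by linarith
      subst this; nlinarith
  choose! ε hε hb using h1
  choose! w0 hw0 hw0' using hpt
  have hin : ∀ y : ℝ, y < 0 → ∀ w ∈ Metric.ball (y : ℂ) (ε y), 0 < σ * w.im →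
      gM a b c w ∈ connectedComponentIn Ω (gM a b c (w0 y (ε y))) := by
    intro y hy w hw hwi
    have him : IsPreconnected (gM a b c '' (Metric.ball (y : ℂ) (ε y) ∩ {w | 0 < σ * w.im})) := by
      apply (hconv y (ε y)).image
      intro u hu
      exact (gM_continuousAt (hb y hy u hu.1).1).continuousWithinAt
    refine him.subset_connectedComponentIn ⟨_, ⟨hw0 y _ (hε y hy), hw0' y _ (hε y hy)⟩, rfl⟩ ?_
      ⟨w, ⟨hw, hwi⟩, rfl⟩
    rintro _ ⟨u, hu, rfl⟩
    exact (hb y hy u hu.1).2 hu.2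
  have hconst : ∀ y : ℝ, y < 0 → connectedComponentIn Ω (gM a b c (w0 y (ε y))) =
      connectedComponentIn Ω (gM a b c (w0 (-1) (ε (-1)))) := by
    intro y hy
    refine (isPreconnected_Iio (a := (0 : ℝ))).induction₂
      (fun y y' => connectedComponentIn Ω (gM a b c (w0 y (ε y))) =
        connectedComponentIn Ω (gM a b c (w0 y' (ε y')))) ?_ ?_ ?_ hy (by norm_num : (-1 : ℝ) ∈ Set.Iio 0)
    · intro y hy
      have hy' : y < 0 := hy
      have e1 : ∀ᶠ y' : ℝ in 𝓝 y, (y' : ℂ) ∈ Metric.ball (y : ℂ) (ε y) :=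
        Complex.continuous_ofReal.continuousAt.eventually
          (Metric.isOpen_ball.mem_nhds (Metric.mem_ball_self (hε y hy')))
      filter_upwards [self_mem_nhdsWithin, nhdsWithin_le_nhds e1] with y' hy'' hball
      have hy2 : y' < 0 := hy''
      obtain ⟨δ, hδ, hδb⟩ := Metric.isOpen_iff.1
        (Metric.isOpen_ball.inter Metric.isOpen_ball) (y' : ℂ)
        ⟨hball, Metric.mem_ball_self (hε y' hy2)⟩
      have m := hδb (hw0 y' δ hδ)
      have m1 := hin y hy' _ m.1 (hw0' y' δ hδ)
      have m2 := hin y' hy2 _ m.2 (hw0' y' δ hδ)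
      rw [connectedComponentIn_eq m1, connectedComponentIn_eq m2]
    · intro x y z _ _ _ h1 h2; exact h1.trans h2
    · intro x y _ _ h1; exact h1.symm
  refine ⟨gM a b c (w0 (-1) (ε (-1))), ?_, ?_⟩
  · have := hε (-1) (by norm_num)
    exact (hb (-1) (by norm_num) _ (hw0 _ _ this)).2 (hw0' _ _ this)
  · intro y hy
    filter_upwards [Metric.isOpen_ball.mem_nhds (Metric.mem_ball_self (hε y hy))] with w hw hwi
    rw [← hconst y hy]
    exact hin y hy w hw hwi

/-- If a set avoiding the arc accumulates at an interior point of the arc, it meets a side. -/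
theorem side_of_closure {a b c : ℂ} (hab : a ≠ b) (hc : c ∈ slitPlane) {L R C : Set ℂ}
    {y : ℝ} (hy : y < 0)
    (hL : ∀ᶠ w in 𝓝 (y : ℂ), 0 < (1 : ℝ) * w.im → gM a b c w ∈ L)
    (hR : ∀ᶠ w in 𝓝 (y : ℂ), 0 < (-1 : ℝ) * w.im → gM a b c w ∈ R)
    (hC : Disjoint C (Arc a b c)) (hx : gM a b c y ∈ closure C) :
    (C ∩ L).Nonempty ∨ (C ∩ R).Nonempty := by
  have hyc := neg_ne hc hy.le
  have hne := gM_ne hab hc hyc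
  have hcont := fM_continuousAt (b := b) (c := c) hne
  have hre : ∀ᶠ w in 𝓝 (y : ℂ), w.re < 0 :=
    (isOpen_lt continuous_re continuous_const).mem_nhds (by simpa using hy)
  have e := hL.and (hR.and hre)
  rw [← fM_gM hab hc hyc] at e
  have e2 := (hcont.eventually e).and (isOpen_ne.mem_nhds hne)
  obtain ⟨p, hp, hpC⟩ := mem_closure_iff_nhds.1 hx _ e2
  obtain ⟨⟨h1, h2, h3⟩, h4⟩ := hp
  have h4' : p ≠ a := h4
  rw [gM_fM hab hc h4'] at h1 h2
  have hnot := Set.disjoint_left.1 hC hpC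
  rw [mem_Arc, not_not, mem_slitPlane_iff] at hnot
  have him : (fM a b c p).im ≠ 0 := by
    rcases hnot with h | h
    · linarith
    · exact h
  rcases lt_or_gt_of_ne him with h | h
  · right; exact ⟨p, hpC, h2 (by linarith)⟩
  · left; exact ⟨p, hpC, h1 (by linarith)⟩

theorem comp_eq_of_inter {Ω : Set ℂ} {x y : ℂ}
    (h : (connectedComponentIn Ω x ∩ connectedComponentIn Ω y).Nonempty) :
    connectedComponentIn Ω x = connectedComponentIn Ω y := by
  obtain ⟨z, h1, h2⟩ := h
  rw [connectedComponentIn_eq h1, connectedComponentIn_eq h2]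

theorem remove_aux {a b c : ℂ} (hab : a ≠ b) (hc : c ∈ slitPlane) {Ω : Set ℂ} (hΩ : IsOpen Ω)
    (hpre : IsPreconnected Ω) (haΩ : a ∉ Ω) (hbΩ : b ∉ Ω) (hb : ∀ᶠ p in 𝓝[≠] b, p ∈ Ω)
    (hI : ∀ y : ℝ, y < 0 → gM a b c y ∈ Ω) : IsPreconnected (Ω \ Arc a b c) := by
  have hopen : IsOpen (Ω \ Arc a b c) := hΩ.sdiff (isClosed_Arc _ _ _)
  have hh : ∀ y : ℝ, y < 0 → ∀ᶠ p in 𝓝 (gM a b c y), p ∉ Arc a b c → p ∈ Ω \ Arc a b c := by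
    intro y hy
    filter_upwards [hΩ.mem_nhds (hI y hy)] with p hp hp2 using ⟨hp, hp2⟩
  obtain ⟨xL, hxL, hL⟩ := side hab hc hh 1 (by norm_num)
  obtain ⟨xR, hxR, hR⟩ := side hab hc hh (-1) (by norm_num)
  -- the two sides agree
  have hLR : connectedComponentIn (Ω \ Arc a b c) xL = connectedComponentIn (Ω \ Arc a b c) xR := by
    have h0c : (0 : ℂ) ≠ c := (slitPlane_ne_zero hc).symm
    have hg0 : gM a b c 0 = b := by
      have := slitPlane_ne_zero hc
      simp [gM, this]
    have hb' : ∀ᶠ p in 𝓝 (gM a b c 0), p ≠ b → p ∈ Ω := by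
      rw [hg0]; exact eventually_nhdsWithin_iff.1 hb
    obtain ⟨ε, hε, hball⟩ := Metric.eventually_nhds_iff_ball.1
      (((gM_continuousAt (a := a) (b := b) h0c).eventually hb').and (isOpen_ne.mem_nhds h0c))
    have hK : IsPreconnected (Metric.ball (0 : ℂ) ε ∩ slitPlane) := by
      have h1 : StarConvex ℝ ((ε / 2 : ℝ) : ℂ) (Metric.ball (0 : ℂ) ε ∩ slitPlane) := by
        apply StarConvex.inter
        · apply (convex_ball _ _).starConvex
          rw [mem_ball_zero_iff, norm_real, Real.norm_eq_abs, abs_of_pos (by positivity)]; linarith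
        · intro v hv s t hs ht hst
          rw [mem_slitPlane_iff] at hv ⊢
          simp only [add_re, add_im, smul_re, smul_im, smul_eq_mul, ofReal_re, ofReal_im, mul_zero,
            zero_add]
          by_cases ht0 : t = 0
          · left; subst ht0; have : s = 1 := by linarith
            subst this; simp; linarith
          · have : 0 < t := lt_of_le_of_ne ht (Ne.symm ht0)
            rcases hv with h | h
            · left; nlinarith [mul_pos this h, mul_nonneg hs hε.le]
            · right; exact mul_ne_zero ht0 h
      exact (h1.isPathConnected (by
        refine Set.mem_inter ?_ ?_
        · rw [mem_ball_zero_iff, norm_real, Real.norm_eq_abs, abs_of_pos (by positivity)]; linarith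
        · rw [ofReal_mem_slitPlane]; positivity)).isConnected.isPreconnected
    have hK2 : IsPreconnected (gM a b c '' (Metric.ball (0 : ℂ) ε ∩ slitPlane)) := by
      apply hK.image
      intro u hu
      exact (gM_continuousAt (hball u hu.1).2).continuousWithinAt
    have hK3 : gM a b c '' (Metric.ball (0 : ℂ) ε ∩ slitPlane) ⊆ Ω \ Arc a b c := by
      rintro _ ⟨u, hu, rfl⟩
      have h2 : gM a b c u ∉ Arc a b c := by
        rw [mem_Arc, not_not, fM_gM hab hc (hball u hu.1).2]; exact hu.2
      refine ⟨(hball u hu.1).1 ?_, h2⟩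
      intro h; rw [h] at h2; exact h2 (right_mem _ _ _)
    have hym : -(ε / 2) < 0 := by linarith
    have hyb : ((-(ε / 2) : ℝ) : ℂ) ∈ Metric.ball (0 : ℂ) ε := by
      rw [mem_ball_zero_iff, norm_real, Real.norm_eq_abs, abs_neg, abs_of_pos (by positivity)]
      linarith
    have ex : ∀ σ : ℝ, σ ≠ 0 → ∀ S : Set ℂ, (∀ᶠ w in 𝓝 ((-(ε / 2) : ℝ) : ℂ), 0 < σ * w.im →
        gM a b c w ∈ S) → (gM a b c '' (Metric.ball (0 : ℂ) ε ∩ slitPlane) ∩ S).Nonempty := by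
      intro σ hσ S hS
      have hlim : Tendsto (fun t : ℝ => ((-(ε / 2) : ℝ) : ℂ) + (t * σ : ℝ) * I) (𝓝[>] 0)
          (𝓝 ((-(ε / 2) : ℝ) : ℂ)) := by
        apply tendsto_nhdsWithin_of_tendsto_nhds
        have : Continuous (fun t : ℝ => ((-(ε / 2) : ℝ) : ℂ) + (t * σ : ℝ) * I) := by fun_prop
        convert this.tendsto 0 using 2
        simp
      have := (hlim.eventually (hS.and (Metric.isOpen_ball.mem_nhds hyb))).and self_mem_nhdsWithin
      obtain ⟨t, ⟨h1, h2⟩, h3⟩ := this.exists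
      have h3' : 0 < t := h3
      have him : (((-(ε / 2) : ℝ) : ℂ) + (t * σ : ℝ) * I).im = t * σ := by simp
      rw [him] at h1
      refine ⟨_, ⟨_, ⟨h2, ?_⟩, rfl⟩, h1 ?_⟩
      · rw [mem_slitPlane_iff]; right; rw [him]; exact mul_ne_zero h3'.ne' hσ
      · have : 0 < σ * σ := mul_self_pos.2 hσ
        nlinarith
    obtain ⟨p, hp1, hp2⟩ := ex 1 (by norm_num) _ (hL _ hym)
    obtain ⟨q, hq1, hq2⟩ := ex (-1) (by norm_num) _ (hR _ hym)
    have := hK2.subset_connectedComponentIn hp1 hK3 hq1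
    rw [connectedComponentIn_eq hp2, connectedComponentIn_eq hq2, connectedComponentIn_eq this]
  have hall : ∀ x ∈ Ω \ Arc a b c,
      connectedComponentIn (Ω \ Arc a b c) x = connectedComponentIn (Ω \ Arc a b c) xL := by
    intro x hx
    by_contra hne
    set C := connectedComponentIn (Ω \ Arc a b c) x with hCdef
    have hCs : C ⊆ Ω \ Arc a b c := connectedComponentIn_subset _ _
    have hsub : Ω ⊆ C := by
      apply hpre.subset_of_closure_inter_subset hopen.connectedComponentIn
      · exact ⟨x, hx.1, mem_connectedComponentIn hx⟩
      · rintro p ⟨hp1, hp2⟩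
        by_cases hpA : p ∈ Arc a b c
        · exfalso
          rcases mem_Arc_cases hab hc hpA with h | h | ⟨y, hy, h⟩
          · exact haΩ (h ▸ hp2)
          · exact hbΩ (h ▸ hp2)
          · have hd : Disjoint C (Arc a b c) :=
              Set.disjoint_left.2 fun q hq => (hCs hq).2
            rw [h] at hp1
            rcases side_of_closure hab hc hy (hL y hy) (hR y hy) hd hp1 with h2 | h2
            · exact hne (comp_eq_of_inter h2)
            · exact hne ((comp_eq_of_inter h2).trans hLR.symm)
        · have hpx : p ∈ Ω \ Arc a b c := ⟨hp2, hpA⟩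
          obtain ⟨q, hq1, hq2⟩ := mem_closure_iff_nhds.1 hp1 _
            (hopen.connectedComponentIn.mem_nhds (mem_connectedComponentIn hpx))
          have := comp_eq_of_inter ⟨q, hq1, hq2⟩
          rw [← this]
          exact mem_connectedComponentIn hpx
    exact (hCs (hsub (hI (-1) (by norm_num)))).2 (gM_neg_mem hab hc (by norm_num))
  apply isPreconnected_of_forall xL
  intro x hx
  refine ⟨connectedComponentIn (Ω \ Arc a b c) xL, connectedComponentIn_subset _ _,
    mem_connectedComponentIn hxL, ?_, isPreconnected_connectedComponentIn⟩
  rw [← hall x hx]; exact mem_connectedComponentIn hx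

end SC

namespace SC
open Complex Topology Filter

theorem remove {a b c : ℂ} (hab : a ≠ b) (hc : c ∈ slitPlane) {Ω : Set ℂ} (hΩ : IsOpen Ω)
    (hpre : IsPreconnected Ω) (haΩ : a ∉ Ω) (hbΩ : b ∉ Ω)
    (hb : (∀ᶠ p in 𝓝[≠] a, p ∈ Ω) ∨ ∀ᶠ p in 𝓝[≠] b, p ∈ Ω)
    (hI : ∀ p ∈ Arc a b c, p ≠ a → p ≠ b → p ∈ Ω) : IsPreconnected (Ω \ Arc a b c) := by
  rcases hb with hb | hb
  · rw [Arc_swap]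
    rw [Arc_swap] at hI
    have hc' := (inv_slit_iff c).1 hc
    refine remove_aux hab.symm hc' hΩ hpre hbΩ haΩ hb fun y hy => ?_
    exact hI _ (gM_neg_mem hab.symm hc' hy.le) (gM_neg_ne_right hab.symm hc' hy)
      (gM_ne hab.symm hc' (neg_ne hc' hy.le))
  · refine remove_aux hab hc hΩ hpre haΩ hbΩ hb fun y hy => ?_
    exact hI _ (gM_neg_mem hab hc hy.le) (gM_ne hab hc (neg_ne hc hy.le))
      (gM_neg_ne_right hab hc hy)

theorem two_arcs {a b c a' b' c' : ℂ} (hab : a ≠ b) (hc : c ∈ slitPlane) (hab' : a' ≠ b')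
    (hc' : c' ∈ slitPlane) {P : Set ℂ} (hP : P.Finite) (ha : a ∈ P) (hb : b ∈ P) (ha' : a' ∈ P)
    (hb' : b' ∈ P) (hI : ∀ p ∈ Arc a b c, p ≠ a → p ≠ b → p ∉ P)
    (hI' : ∀ p ∈ Arc a' b' c', p ≠ a' → p ≠ b' → p ∉ P ∧ p ∉ Arc a b c)
    (hfree : a' ∉ Arc a b c ∨ b' ∉ Arc a b c) :
    IsPreconnected ((Pᶜ \ Arc a b c) \ Arc a' b' c') := by
  have hPo : IsOpen Pᶜ := hP.isClosed.isOpen_compl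
  have hnear : ∀ x ∈ P, ∀ᶠ p in 𝓝[≠] x, p ∈ Pᶜ := by
    intro x _
    have : (P \ {x}).Finite := hP.subset Set.sdiff_subset
    have h2 : (P \ {x})ᶜ ∈ 𝓝 x := this.isClosed.isOpen_compl.mem_nhds (by simp)
    rw [eventually_nhdsWithin_iff]
    filter_upwards [h2] with p hp hpx hpP
    exact hp ⟨hpP, hpx⟩
  have h1 : IsPreconnected (Pᶜ \ Arc a b c) := by
    refine remove hab hc hPo ?_ (by simpa) (by simpa) (Or.inl (hnear a ha)) hI
    exact (hP.countable.isConnected_compl_of_one_lt_rank (by simp)).isPreconnected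
  have hnear2 : ∀ x ∈ P, x ∉ Arc a b c → ∀ᶠ p in 𝓝[≠] x, p ∈ Pᶜ \ Arc a b c := by
    intro x hx hx2
    filter_upwards [hnear x hx, nhdsWithin_le_nhds ((isClosed_Arc a b c).isOpen_compl.mem_nhds hx2)]
      with p h1 h2 using ⟨h1, h2⟩
  refine remove hab' hc' (hPo.sdiff (isClosed_Arc _ _ _)) h1 (fun h => h.1 ha') (fun h => h.1 hb')
    ?_ (fun p hp h1 h2 => hI' p hp h1 h2)
  exact hfree.imp (hnear2 a' ha') (hnear2 b' hb')

section planar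
variable {E : Type*} [Fintype E] {a b c : E → ℂ}

/-- Complement of all arcs. -/
def Uset (a b c : E → ℂ) : Set ℂ := {p | ∀ e, p ∉ Arc (a e) (b e) (c e)}

theorem isOpen_Uset : IsOpen (Uset a b c) := by
  have : Uset a b c = ⋂ e, (Arc (a e) (b e) (c e))ᶜ := by
    ext p; simp [Uset]
  rw [this]
  exact isOpen_iInter_of_finite fun e => (isClosed_Arc _ _ _).isOpen_compl

theorem near_Uset (hab : ∀ e, a e ≠ b e) (hc : ∀ e, c e ∈ slitPlane)
    (H1 : ∀ e e', e ≠ e' → ∀ p ∈ Arc (a e) (b e) (c e), p ≠ a e → p ≠ b e →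
      p ∉ Arc (a e') (b e') (c e')) (e : E) (y : ℝ) (hy : y < 0) :
    ∀ᶠ p in 𝓝 (gM (a e) (b e) (c e) y), p ∉ Arc (a e) (b e) (c e) → p ∈ Uset a b c := by
  have : ∀ e', ∀ᶠ p in 𝓝 (gM (a e) (b e) (c e) y), p ∉ Arc (a e) (b e) (c e) →
      p ∉ Arc (a e') (b e') (c e') := by
    intro e'
    by_cases h : e = e'
    · subst h; exact Eventually.of_forall fun p hp => hp
    · have h1 := H1 e e' h _ (gM_neg_mem (hab e) (hc e) hy.le)
        (gM_ne (hab e) (hc e) (neg_ne (hc e) hy.le)) (gM_neg_ne_right (hab e) (hc e) hy)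
      filter_upwards [(isClosed_Arc _ _ _).isOpen_compl.mem_nhds h1] with p hp _ using hp
  filter_upwards [eventually_all.2 this] with p hp hpe e' using hp e' hpe

theorem fiber_contra (hab : ∀ e, a e ≠ b e) (hc : ∀ e, c e ∈ slitPlane)
    (H1 : ∀ e e', e ≠ e' → ∀ p ∈ Arc (a e) (b e) (c e), p ≠ a e → p ≠ b e →
      p ∉ Arc (a e') (b e') (c e'))
    (H2 : ∀ e e', e ≠ e' → a e ∉ Arc (a e') (b e') (c e') ∨ b e ∉ Arc (a e') (b e') (c e'))
    (L R : E → ℂ)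
    (hL : ∀ e, ∀ y : ℝ, y < 0 → ∀ᶠ w in 𝓝 (y : ℂ), 0 < (1 : ℝ) * w.im →
      gM (a e) (b e) (c e) w ∈ connectedComponentIn (Uset a b c) (L e))
    (hR : ∀ e, ∀ y : ℝ, y < 0 → ∀ᶠ w in 𝓝 (y : ℂ), 0 < (-1 : ℝ) * w.im →
      gM (a e) (b e) (c e) w ∈ connectedComponentIn (Uset a b c) (R e))
    (x : ℂ) (hx : x ∈ Uset a b c) (e1 e2 e3 : E) (h12 : e1 ≠ e2) (h13 : e1 ≠ e3) (h23 : e2 ≠ e3)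
    (hT : ∀ e, (connectedComponentIn (Uset a b c) x = connectedComponentIn (Uset a b c) (L e) ∨
      connectedComponentIn (Uset a b c) x = connectedComponentIn (Uset a b c) (R e)) →
      e = e1 ∨ e = e2) : False := by
  set C := connectedComponentIn (Uset a b c) x with hC
  set P : Set ℂ := Set.range a ∪ Set.range b with hPdef
  have hP : P.Finite := (Set.finite_range a).union (Set.finite_range b)
  have hPa : ∀ e, a e ∈ P := fun e => Or.inl ⟨e, rfl⟩
  have hPb : ∀ e, b e ∈ P := fun e => Or.inr ⟨e, rfl⟩
  have hIP : ∀ e, ∀ p ∈ Arc (a e) (b e) (c e), p ≠ a e → p ≠ b e → p ∉ P := by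
    rintro e p hp h1 h2 (⟨e', rfl⟩ | ⟨e', rfl⟩)
    · by_cases h : e = e'
      · subst h; exact h1 rfl
      · exact H1 e e' h _ hp h1 h2 (left_mem _ _ _)
    · by_cases h : e = e'
      · subst h; exact h2 rfl
      · exact H1 e e' h _ hp h1 h2 (right_mem _ _ _)
  have hK := two_arcs (hab e1) (hc e1) (hab e2) (hc e2) hP (hPa e1) (hPb e1) (hPa e2) (hPb e2)
    (hIP e1) (fun p hp h1 h2 => ⟨hIP e2 p hp h1 h2, H1 e2 e1 h12.symm p hp h1 h2⟩)
    (H2 e2 e1 h12.symm)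
  set K := (Pᶜ \ Arc (a e1) (b e1) (c e1)) \ Arc (a e2) (b e2) (c e2) with hKdef
  have hUK : Uset a b c ⊆ K := by
    intro p hp
    refine ⟨⟨?_, hp e1⟩, hp e2⟩
    rintro (⟨e', rfl⟩ | ⟨e', rfl⟩)
    · exact hp e' (left_mem _ _ _)
    · exact hp e' (right_mem _ _ _)
  have hCU : C ⊆ Uset a b c := connectedComponentIn_subset _ _
  have hopen : IsOpen (Uset a b c) := isOpen_Uset
  have hsub : K ⊆ C := by
    apply hK.subset_of_closure_inter_subset hopen.connectedComponentIn
    · exact ⟨x, hUK hx, mem_connectedComponentIn hx⟩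
    · rintro p ⟨hp1, hp2⟩
      by_cases hpU : p ∈ Uset a b c
      · obtain ⟨q, hq1, hq2⟩ := mem_closure_iff_nhds.1 hp1 _
          (hopen.connectedComponentIn.mem_nhds (mem_connectedComponentIn hpU))
        have := comp_eq_of_inter ⟨q, hq1, hq2⟩
        rw [← this]
        exact mem_connectedComponentIn hpU
      · exfalso
        have hpU' : ∃ e, p ∈ Arc (a e) (b e) (c e) := by
          by_contra hcon; push Not at hcon; exact hpU hcon
        obtain ⟨e, he⟩ := hpU'
        rcases mem_Arc_cases (hab e) (hc e) he with h | h | ⟨y, hy, h⟩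
        · exact hp2.1.1 (h ▸ hPa e)
        · exact hp2.1.1 (h ▸ hPb e)
        · have hd : Disjoint C (Arc (a e) (b e) (c e)) :=
            Set.disjoint_left.2 fun q hq => hCU hq e
          have hp1' := hp1
          rw [h] at hp1'
          have := (side_of_closure (hab e) (hc e) hy (hL e y hy) (hR e y hy) hd hp1').imp
            comp_eq_of_inter comp_eq_of_inter
          rcases hT e this with rfl | rfl
          · exact hp2.1.2 he
          · exact hp2.2 he
  have hm : (-1 : ℝ) < 0 := by norm_num
  have q1 := gM_neg_mem (hab e3) (hc e3) hm.le
  have q2 := gM_ne (hab e3) (hc e3) (neg_ne (hc e3) hm.le)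
  have q3 := gM_neg_ne_right (hab e3) (hc e3) hm
  refine hCU (hsub ⟨⟨hIP e3 _ q1 q2 q3, H1 e3 e1 h13.symm _ q1 q2 q3⟩,
    H1 e3 e2 h23.symm _ q1 q2 q3⟩) e3 q1

end planar

end SC

namespace SC
open Complex Topology Filter

section planar
variable {E : Type*} [Fintype E] {V : Type*} [Fintype V]

/-- Potential function. -/
def Hfun (a b c : E → ℂ) (z : E → ℂ) (p : ℂ) : ℂ := ∑ e, z e * Complex.log (fM (a e) (b e) (c e) p)

theorem fM_hasDeriv {a b c p : ℂ} (hc : c ≠ 0) (hp : p ≠ a) (hp' : p ≠ b)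
    (hs : fM a b c p ∈ slitPlane) :
    HasDerivAt (fun p => Complex.log (fM a b c p)) (1 / (p - b) - 1 / (p - a)) p := by
  have h1 : p - a ≠ 0 := sub_ne_zero.2 hp
  have h2 : p - b ≠ 0 := sub_ne_zero.2 hp'
  have h3 : HasDerivAt (fM a b c) ((c * 1 * (p - a) - c * (p - b) * 1) / (p - a) ^ 2) p := by
    unfold fM
    exact ((((hasDerivAt_id p).sub_const b).const_mul c).div ((hasDerivAt_id p).sub_const a) h1)
  convert h3.clog hs using 1
  unfold fM
  field_simp

theorem Hfun_const [DecidableEq V] {src tgt : E → V} {pos : V → ℂ} {c : E → ℂ} (hc : ∀ e, c e ∈ slitPlane)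
    (z : E → ℂ)
    (hz : ∀ v, ∑ e, z e * ((if tgt e = v then 1 else 0) - if src e = v then 1 else 0) = 0)
    {C : Set ℂ} (hCo : IsOpen C) (hCp : IsPreconnected C)
    (hCU : C ⊆ Uset (fun e => pos (src e)) (fun e => pos (tgt e)) c) {x y : ℂ} (hx : x ∈ C)
    (hy : y ∈ C) :
    Hfun (fun e => pos (src e)) (fun e => pos (tgt e)) c z x =
    Hfun (fun e => pos (src e)) (fun e => pos (tgt e)) c z y := by
  have hd : ∀ p ∈ C, HasDerivAt (Hfun (fun e => pos (src e)) (fun e => pos (tgt e)) c z) 0 p := by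
    intro p hp
    have hpU := hCU hp
    have h1 : HasDerivAt (Hfun (fun e => pos (src e)) (fun e => pos (tgt e)) c z)
        (∑ e, z e * (1 / (p - pos (tgt e)) - 1 / (p - pos (src e)))) p := by
      have hfun : Hfun (fun e => pos (src e)) (fun e => pos (tgt e)) c z =
        ∑ e, fun p => z e * Complex.log (fM (pos (src e)) (pos (tgt e)) (c e) p) := by
          ext p; simp [Hfun]
      rw [hfun]
      apply HasDerivAt.sum
      intro e _
      have hpe := hpU e
      refine (fM_hasDeriv (slitPlane_ne_zero (hc e)) (ne_of_notMem hpe) ?_ ?_).const_mul (z e)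
      · rintro h; apply hpe; rw [h]; exact right_mem _ _ _
      · rwa [mem_Arc, not_not] at hpe
    convert h1 using 1
    have h2 : ∀ e, z e * (1 / (p - pos (tgt e)) - 1 / (p - pos (src e))) =
        ∑ v, (1 / (p - pos v)) *
          (z e * ((if tgt e = v then 1 else 0) - if src e = v then 1 else 0)) := by
      intro e
      have : ∀ v, (1 / (p - pos v)) *
          (z e * ((if tgt e = v then 1 else 0) - if src e = v then 1 else 0)) =
          (if tgt e = v then z e * (1 / (p - pos v)) else 0) -
          (if src e = v then z e * (1 / (p - pos v)) else 0) := by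
        intro v; split_ifs <;> ring
      simp only [this, Finset.sum_sub_distrib, Finset.sum_ite_eq, Finset.mem_univ, if_true]
      ring
    rw [Finset.sum_congr rfl fun e _ => h2 e, Finset.sum_comm]
    symm
    apply Finset.sum_eq_zero
    intro v _
    rw [← Finset.mul_sum, hz v, mul_zero]
  exact hCo.is_const_of_deriv_eq_zero hCp
    (fun p hp => (hd p hp).differentiableAt.differentiableWithinAt)
    (fun p hp => (hd p hp).deriv) hx hy

/-- Jump of the potential across an edge. -/
theorem jump {a b c : E → ℂ} (hab : ∀ e, a e ≠ b e) (hc : ∀ e, c e ∈ slitPlane)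
    (H1 : ∀ e e', e ≠ e' → ∀ p ∈ Arc (a e) (b e) (c e), p ≠ a e → p ≠ b e →
      p ∉ Arc (a e') (b e') (c e')) (z : E → ℂ) (e : E) (k : ℂ)
    (hL : ∀ᶠ w in 𝓝 ((-1 : ℝ) : ℂ), 0 < (1 : ℝ) * w.im →
      Hfun a b c z (gM (a e) (b e) (c e) w) = k)
    (hR : ∀ᶠ w in 𝓝 ((-1 : ℝ) : ℂ), 0 < (-1 : ℝ) * w.im →
      Hfun a b c z (gM (a e) (b e) (c e) w) = k) : z e = 0 := by
  classical
  have hm : (-1 : ℝ) < 0 := by norm_num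
  have hmc := neg_ne (hc e) hm.le
  have q1 := gM_neg_mem (hab e) (hc e) hm.le
  have q2 := gM_ne (hab e) (hc e) hmc
  have q3 := gM_neg_ne_right (hab e) (hc e) hm
  set G : ℂ → ℂ := fun w => ∑ e' ∈ Finset.univ.erase e,
    z e' * Complex.log (fM (a e') (b e') (c e') (gM (a e) (b e) (c e) w)) with hG
  have hGc : ContinuousAt G ((-1 : ℝ) : ℂ) := by
    apply tendsto_finsetSum
    intro e' he'
    have hne : e ≠ e' := (Finset.ne_of_mem_erase he').symm
    have h1 := H1 e e' hne _ q1 q2 q3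
    apply Tendsto.const_mul
    have h2 : fM (a e') (b e') (c e') (gM (a e) (b e) (c e) ((-1 : ℝ) : ℂ)) ∈ slitPlane := by
      rwa [mem_Arc, not_not] at h1
    exact ((fM_continuousAt (ne_of_notMem h1)).comp (gM_continuousAt hmc)).clog h2
  have hH : ∀ᶠ w in 𝓝 ((-1 : ℝ) : ℂ), Hfun a b c z (gM (a e) (b e) (c e) w) =
      z e * Complex.log w + G w := by
    filter_upwards [isOpen_ne.mem_nhds hmc] with w hw
    unfold Hfun
    rw [← Finset.add_sum_erase _ _ (Finset.mem_univ e), fM_gM (hab e) (hc e) hw]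
  have hup : Tendsto (fun t : ℝ => ((-1 : ℝ) : ℂ) + (t : ℂ) * I) (𝓝[>] 0) (𝓝 ((-1 : ℝ) : ℂ)) := by
    apply tendsto_nhdsWithin_of_tendsto_nhds
    have : Continuous (fun t : ℝ => ((-1 : ℝ) : ℂ) + (t : ℂ) * I) := by fun_prop
    convert this.tendsto 0 using 2
    simp
  have hdn : Tendsto (fun t : ℝ => ((-1 : ℝ) : ℂ) + ((-t : ℝ) : ℂ) * I) (𝓝[>] 0)
      (𝓝 ((-1 : ℝ) : ℂ)) := by
    apply tendsto_nhdsWithin_of_tendsto_nhds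
    have : Continuous (fun t : ℝ => ((-1 : ℝ) : ℂ) + ((-t : ℝ) : ℂ) * I) := by fun_prop
    convert this.tendsto 0 using 2
    simp
  have l1 : Tendsto (fun t : ℝ => Complex.log (((-1 : ℝ) : ℂ) + (t : ℂ) * I)) (𝓝[>] 0)
      (𝓝 (Real.log ‖((-1 : ℝ) : ℂ)‖ + Real.pi * I)) := by
    refine (tendsto_log_nhdsWithin_im_nonneg_of_re_neg_of_im_zero (by simp) (by simp)).comp ?_
    refine tendsto_nhdsWithin_iff.2 ⟨hup, ?_⟩
    filter_upwards [self_mem_nhdsWithin] with t ht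
    have : 0 < t := ht
    simpa using this.le
  have l2 : Tendsto (fun t : ℝ => Complex.log (((-1 : ℝ) : ℂ) + ((-t : ℝ) : ℂ) * I)) (𝓝[>] 0)
      (𝓝 (Real.log ‖((-1 : ℝ) : ℂ)‖ - Real.pi * I)) := by
    refine (tendsto_log_nhdsWithin_im_neg_of_re_neg_of_im_zero (by simp) (by simp)).comp ?_
    refine tendsto_nhdsWithin_iff.2 ⟨hdn, ?_⟩
    filter_upwards [self_mem_nhdsWithin] with t ht
    have : 0 < t := ht
    simpa using this
  have r1 : z e * (Real.log ‖((-1 : ℝ) : ℂ)‖ + Real.pi * I) + G ((-1 : ℝ) : ℂ) = k := by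
    refine tendsto_nhds_unique ((l1.const_mul (z e)).add (hGc.tendsto.comp hup)) ?_
    refine tendsto_const_nhds.congr' ?_
    filter_upwards [hup.eventually hH, hup.eventually hL, self_mem_nhdsWithin] with t h1 h2 h3
    have h3' : 0 < t := h3
    rw [← h2 (by simpa using h3'), h1]; rfl
  have r2 : z e * (Real.log ‖((-1 : ℝ) : ℂ)‖ - Real.pi * I) + G ((-1 : ℝ) : ℂ) = k := by
    refine tendsto_nhds_unique ((l2.const_mul (z e)).add (hGc.tendsto.comp hdn)) ?_
    refine tendsto_const_nhds.congr' ?_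
    filter_upwards [hdn.eventually hH, hdn.eventually hR, self_mem_nhdsWithin] with t h1 h2 h3
    have h3' : 0 < t := h3
    rw [← h2 (by simpa using h3'), h1]; rfl
  have r3 : z e * (2 * (Real.pi * I)) = 0 := by linear_combination r1 - r2
  rcases mul_eq_zero.1 r3 with h | h
  · exact h
  · exfalso
    have : (Real.pi : ℂ) ≠ 0 := by exact_mod_cast Real.pi_ne_zero
    simp [this] at h

theorem planar_bound {src tgt : E → V} {pos : V → ℂ} {c : E → ℂ} (hc : ∀ e, c e ∈ slitPlane)
    (hab : ∀ e, pos (src e) ≠ pos (tgt e))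
    (H1 : ∀ e e', e ≠ e' → ∀ p ∈ Arc (pos (src e)) (pos (tgt e)) (c e), p ≠ pos (src e) →
      p ≠ pos (tgt e) → p ∉ Arc (pos (src e')) (pos (tgt e')) (c e'))
    (H2 : ∀ e e', e ≠ e' → pos (src e) ∉ Arc (pos (src e')) (pos (tgt e')) (c e') ∨
      pos (tgt e) ∉ Arc (pos (src e')) (pos (tgt e')) (c e'))
    (hV : 3 ≤ Fintype.card V) : Fintype.card E + 6 ≤ 3 * Fintype.card V := by
  classical
  by_cases hE : Fintype.card E ≤ 3
  · omega
  push Not at hE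
  set a : E → ℂ := fun e => pos (src e) with ha
  set b : E → ℂ := fun e => pos (tgt e) with hb
  set U := Uset a b c with hU
  have hUo : IsOpen U := isOpen_Uset
  choose L hLU hL using fun e => side (hab e) (hc e) (near_Uset (a := a) (b := b) hab hc H1 e) 1 (by norm_num)
  choose R hRU hR using fun e => side (hab e) (hc e) (near_Uset (a := a) (b := b) hab hc H1 e) (-1) (by norm_num)
  let B : E × Bool → ℂ := fun q => if q.2 then L q.1 else R q.1
  have hBU : ∀ q, B q ∈ U := by
    rintro ⟨e, _ | _⟩
    · exact hRU e
    · exact hLU e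
  let s : E × Bool → Set ℂ := fun q => connectedComponentIn U (B q)
  let F : Finset (Set ℂ) := Finset.univ.image s
  have hfib : 3 * F.card ≤ 2 * Fintype.card E := by
    have h1 := Finset.card_eq_sum_card_image s Finset.univ
    have h2 : ∀ φ ∈ F, 3 ≤ (Finset.univ.filter fun q => s q = φ).card := by
      intro φ hφ
      obtain ⟨q0, -, rfl⟩ := Finset.mem_image.1 hφ
      by_contra hlt
      push Not at hlt
      set T := (Finset.univ.filter fun q => s q = s q0).image Prod.fst with hT
      have hTc : T.card ≤ 2 := Finset.card_image_le.trans (by omega)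
      obtain ⟨T', hTT', hT'⟩ := Finset.exists_superset_card_eq (s := T) (n := 2) hTc (by omega)
      obtain ⟨e1, e2, h12, hT2⟩ := Finset.card_eq_two.1 hT'
      obtain ⟨e3, he3⟩ : ∃ e3, e3 ∉ T' := by
        by_contra hcon
        push Not at hcon
        have : T' = Finset.univ := Finset.eq_univ_iff_forall.2 hcon
        rw [this, Finset.card_univ] at hT'
        omega
      rw [hT2] at he3 hTT'
      simp only [Finset.mem_insert, Finset.mem_singleton, not_or] at he3
      refine fiber_contra (a := a) (b := b) hab hc H1 H2 L R hL hR (B q0) (hBU q0) e1 e2 e3 h12 (Ne.symm he3.1)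
        (Ne.symm he3.2) ?_
      intro e he
      have : e ∈ T := by
        rw [hT, Finset.mem_image]
        rcases he with h | h
        · exact ⟨(e, true), by simp only [Finset.mem_filter, Finset.mem_univ, true_and]; exact h.symm, rfl⟩
        · exact ⟨(e, false), by simp only [Finset.mem_filter, Finset.mem_univ, true_and]; exact h.symm, rfl⟩
      simpa using hTT' this
    have h3 : F.card * 3 ≤ ∑ φ ∈ F, (Finset.univ.filter fun q => s q = φ).card :=
      Finset.card_nsmul_le_sum _ _ _ h2
    rw [Finset.card_univ, Fintype.card_prod, Fintype.card_bool] at h1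
    change _ = ∑ φ ∈ F, _ at h1
    omega
  -- base points
  have hbase : ∀ φ : F, ∃ q, s q = φ.1 := by
    rintro ⟨φ, hφ⟩
    obtain ⟨q, -, h⟩ := Finset.mem_image.1 hφ
    exact ⟨q, h⟩
  choose Q hQ using hbase
  obtain ⟨v0⟩ : Nonempty V := Fintype.card_pos_iff.1 (by omega)
  let bd : V → E → ℂ := fun v e => (if tgt e = v then 1 else 0) - if src e = v then 1 else 0
  let Tm : ((E → ℂ) × ℂ) →ₗ[ℂ] (({v : V // v ≠ v0} → ℂ) × (F → ℂ)) :=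
    { toFun := fun zk => (fun v => ∑ e, zk.1 e * bd v e,
        fun φ => Hfun a b c zk.1 (B (Q φ)) + zk.2)
      map_add' := by
        rintro ⟨z, k⟩ ⟨z', k'⟩
        ext v
        · simp [add_mul, Finset.sum_add_distrib]
        · simp [Hfun, add_mul, Finset.sum_add_distrib]; ring
      map_smul' := by
        rintro m ⟨z, k⟩
        ext v
        · simp [Finset.mul_sum, mul_assoc]
        · simp [Hfun, Finset.mul_sum, mul_assoc, mul_add] }
  have hinj : Function.Injective Tm := by
    rw [← LinearMap.ker_eq_bot, LinearMap.ker_eq_bot']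
    rintro ⟨z, k⟩ h0
    have hz' : ∀ v : {v : V // v ≠ v0}, ∑ e, z e * bd v e = 0 := fun v =>
      congrFun (congrArg Prod.fst h0) v
    have hk : ∀ φ : F, Hfun a b c z (B (Q φ)) + k = 0 := fun φ =>
      congrFun (congrArg Prod.snd h0) φ
    have hz : ∀ v, ∑ e, z e * bd v e = 0 := by
      intro v
      by_cases hv : v = v0
      · subst hv
        have hsum : ∑ u, ∑ e, z e * bd u e = 0 := by
          rw [Finset.sum_comm]
          apply Finset.sum_eq_zero
          intro e _
          rw [← Finset.mul_sum]
          simp [bd, Finset.sum_sub_distrib]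
        rw [← Finset.add_sum_erase _ _ (Finset.mem_univ v)] at hsum
        rw [Finset.sum_eq_zero (s := Finset.univ.erase v), add_zero] at hsum
        · exact hsum
        · intro u hu
          exact hz' ⟨u, Finset.ne_of_mem_erase hu⟩
      · exact hz' ⟨v, hv⟩
    have hval : ∀ q, ∀ p ∈ s q, Hfun a b c z p = -k := by
      intro q p hp
      let φ : F := ⟨s q, Finset.mem_image_of_mem _ (Finset.mem_univ _)⟩
      have h1 := hk φ
      have h2 : s (Q φ) = s q := hQ φ
      have h3 : B (Q φ) ∈ s q := h2 ▸ mem_connectedComponentIn (hBU _)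
      have := Hfun_const (pos := pos) hc z hz (C := s q) hUo.connectedComponentIn isPreconnected_connectedComponentIn
        (connectedComponentIn_subset _ _) hp h3
      rw [this]; linear_combination h1
    have hz0 : z = 0 := by
      ext e
      refine jump (a := a) (b := b) hab hc H1 z e (-k) ?_ ?_
      · filter_upwards [hL e (-1) (by norm_num)] with w hw hwi
        exact hval (e, true) _ (hw hwi)
      · filter_upwards [hR e (-1) (by norm_num)] with w hw hwi
        exact hval (e, false) _ (hw hwi)
    obtain ⟨e0⟩ : Nonempty E := Fintype.card_pos_iff.1 (by omega)
    have := hval (e0, true) _ (mem_connectedComponentIn (hBU _))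
    rw [hz0] at this
    have hk0 : k = 0 := by simpa [Hfun] using this.symm
    rw [hz0, hk0]; rfl
  have hdim := LinearMap.finrank_le_finrank_of_injective hinj
  simp only [Module.finrank_prod, Module.finrank_fintype_fun_eq_card, Module.finrank_self,
    Fintype.card_coe] at hdim
  have hcardv : Fintype.card {v : V // v ≠ v0} = Fintype.card V - 1 := by
    simp [Fintype.card_subtype_compl]
  omega

end planar

end SC

namespace SC
open Complex Topology Filter

theorem not_slit {z : ℂ} (h : z ∉ slitPlane) : ∃ t : ℝ, 0 ≤ t ∧ z = -(t : ℂ) := by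
  rw [mem_slitPlane_iff, not_or, not_lt, not_not] at h
  refine ⟨-z.re, by linarith [h.1], ?_⟩
  apply Complex.ext <;> simp [h.2]

theorem neg_notSlit {t : ℝ} (h : 0 ≤ t) : (-(t : ℂ)) ∉ slitPlane := by
  rw [mem_slitPlane_iff, not_or, not_lt, not_not]
  simpa using h

theorem arc_unbounded {a b c : ℂ} (hab : a ≠ b) (hc0 : c ≠ 0) (hc : c ∉ slitPlane) :
    ¬ Bornology.IsBounded (Arc a b c) := by
  intro hB
  obtain ⟨r, hr, rfl⟩ := not_slit hc
  obtain ⟨M, hM⟩ := hB.exists_norm_le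
  have hd : b - a ≠ 0 := sub_ne_zero.2 hab.symm
  have hdn : 0 < ‖b - a‖ := norm_pos_iff.2 hd
  have key : ∀ t : ℝ, 1 ≤ t → a + t * (b - a) ∈ Arc a b (-(r : ℂ)) := by
    intro t ht
    have htc : (t : ℂ) ≠ 0 := by
      have : t ≠ 0 := by linarith
      exact_mod_cast this
    rw [mem_Arc]
    have : fM a b (-(r : ℂ)) (a + t * (b - a)) = -((r * ((t - 1) / t) : ℝ) : ℂ) := by
      unfold fM
      push_cast
      have : a + t * (b - a) - a = t * (b - a) := by ring
      rw [this]
      field_simp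
      ring
    rw [this]
    apply neg_notSlit
    have : 0 ≤ t - 1 := by linarith
    positivity
  set t : ℝ := 1 + (|M| + ‖a‖ + 1) / ‖b - a‖ with ht
  have ht1 : 1 ≤ t := by
    have : 0 ≤ (|M| + ‖a‖ + 1) / ‖b - a‖ := by positivity
    linarith
  have h1 := hM _ (key t ht1)
  have h2 : ‖(t : ℂ) * (b - a)‖ ≤ ‖a + t * (b - a)‖ + ‖a‖ := by
    have := norm_sub_le (a + t * (b - a)) a
    simpa using this
  have h3 : ‖(t : ℂ) * (b - a)‖ = ‖b - a‖ + (|M| + ‖a‖ + 1) := by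
    rw [norm_mul, Complex.norm_real, Real.norm_of_nonneg (by linarith), ht]
    field_simp
  have := le_abs_self M
  linarith [norm_nonneg a]

theorem trim {A : Set ℂ} (hA : IsPreconnected A) (hB : Bornology.IsBounded A) {a b : ℂ}
    (ha : a ∈ A) (hb : b ∈ A) (hab : a ≠ b) {α γ β1 β2 : ℝ} (hne : α ≠ 0 ∨ β1 ≠ 0 ∨ β2 ≠ 0)
    (h : ∀ p ∈ A, α * (p.re ^ 2 + p.im ^ 2) + β1 * p.re + β2 * p.im + γ = 0) :
    ∃ c ∈ slitPlane, Arc a b c ⊆ A := by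
  have hd : b - a ≠ 0 := sub_ne_zero.2 hab.symm
  set m1 : ℝ := 2 * α * a.re + β1 with hm1
  set m2 : ℝ := 2 * α * a.im + β2 with hm2
  have hq : ∀ p ∈ A, α * ((p.re - a.re) ^ 2 + (p.im - a.im) ^ 2) + m1 * (p.re - a.re)
      + m2 * (p.im - a.im) = 0 := by
    intro p hp
    have := h p hp; have := h a ha
    rw [hm1, hm2]; linarith
  have hdpos : 0 < (b.re - a.re) ^ 2 + (b.im - a.im) ^ 2 := by
    have := Complex.normSq_pos.2 hd
    rw [Complex.normSq_apply] at this
    simp only [sub_re, sub_im] at this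
    nlinarith
  set m : ℂ := ⟨m1, m2⟩ with hm
  have hm0 : m ≠ 0 := by
    intro h0
    have e1 : m1 = 0 := congrArg re h0
    have e2 : m2 = 0 := congrArg im h0
    have := hq b hb
    rw [e1, e2] at this
    have hα : α = 0 := by
      rcases mul_eq_zero.1 (show α * ((b.re - a.re) ^ 2 + (b.im - a.im) ^ 2) = 0 by linarith) with h | h
      · exact h
      · linarith
    rw [hm1, hα] at e1
    rw [hm2, hα] at e2
    rcases hne with h | h | h
    · exact h hα
    · apply h; linarith
    · apply h; linarith
  set κ : ℂ := I * m / (b - a) with hκ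
  have hκ0 : κ ≠ 0 := div_ne_zero (mul_ne_zero I_ne_zero hm0) hd
  have hreal : ∀ p ∈ A, p ≠ a → ∃ r : ℝ, κ * (p - b) = r * (p - a) := by
    intro p hp hpa
    have hpn : p - a ≠ 0 := sub_ne_zero.2 hpa
    have hppos : 0 < (p.re - a.re) ^ 2 + (p.im - a.im) ^ 2 := by
      have := Complex.normSq_pos.2 hpn
      rw [Complex.normSq_apply] at this
      simp only [sub_re, sub_im] at this
      nlinarith
    have h1 := hq p hp
    have h2 := hq b hb
    refine ⟨(κ * (p - b) / (p - a)).re, ?_⟩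
    have him : (κ * (p - b) / (p - a)).im = 0 := by
      have : κ * (p - b) / (p - a) = I * (m * (b - a)⁻¹ - m * (p - a)⁻¹) := by
        rw [hκ]; field_simp; ring
      rw [this, I_mul_im]
      simp only [sub_re, mul_re, inv_re, inv_im, normSq_apply, sub_im, hm]
      have e1 : (b.re - a.re) * (b.re - a.re) + (b.im - a.im) * (b.im - a.im) ≠ 0 := by
        nlinarith
      have e2 : (p.re - a.re) * (p.re - a.re) + (p.im - a.im) * (p.im - a.im) ≠ 0 := by
        nlinarith
      have f1 : m1 * ((b.re - a.re) / ((b.re - a.re) * (b.re - a.re) + (b.im - a.im) * (b.im - a.im)))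
        - m2 * (-(b.im - a.im) / ((b.re - a.re) * (b.re - a.re) + (b.im - a.im) * (b.im - a.im))) = -α := by
        field_simp; linarith
      have f2 : m1 * ((p.re - a.re) / ((p.re - a.re) * (p.re - a.re) + (p.im - a.im) * (p.im - a.im)))
        - m2 * (-(p.im - a.im) / ((p.re - a.re) * (p.re - a.re) + (p.im - a.im) * (p.im - a.im))) = -α := by
        field_simp; linarith
      linarith
    have h3 : ((κ * (p - b) / (p - a)).re : ℂ) = κ * (p - b) / (p - a) := by
      apply Complex.ext <;> simp [him]
    rw [h3]; field_simp
  -- one of the two arcs is contained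
  have hor : Arc a b κ ⊆ A ∨ Arc a b (-κ) ⊆ A := by
    by_contra hcon
    rw [not_or, not_subset, not_subset] at hcon
    obtain ⟨⟨p1, h1, h1A⟩, ⟨p2, h2, h2A⟩⟩ := hcon
    obtain ⟨t1, ht1, e1⟩ := not_slit h1
    obtain ⟨t2, ht2, e2⟩ := not_slit h2
    have p1a : p1 - a ≠ 0 := sub_ne_zero.2 (by rintro rfl; exact h1A ha)
    have p2a : p2 - a ≠ 0 := sub_ne_zero.2 (by rintro rfl; exact h2A ha)
    have p1b : p1 - b ≠ 0 := sub_ne_zero.2 (by rintro rfl; exact h1A hb)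
    have p2b : p2 - b ≠ 0 := sub_ne_zero.2 (by rintro rfl; exact h2A hb)
    have E1 : κ * (p1 - b) = -t1 * (p1 - a) := by
      unfold fM at e1
      rwa [div_eq_iff p1a] at e1
    have E2 : κ * (p2 - b) = t2 * (p2 - a) := by
      unfold fM at e2
      rw [div_eq_iff p2a] at e2
      linear_combination -e2
    have ht1' : 0 < t1 := by
      refine lt_of_le_of_ne ht1 ?_
      rintro rfl
      apply mul_ne_zero hκ0 p1b; rw [E1]; simp
    have ht2' : 0 < t2 := by
      refine lt_of_le_of_ne ht2 ?_
      rintro rfl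
      apply mul_ne_zero hκ0 p2b; rw [E2]; simp
    have uniq : ∀ (s : ℂ) (p q : ℂ), p - a ≠ 0 → κ * (p - b) = s * (p - a) →
        κ * (q - b) = s * (q - a) → p = q := by
      intro s p q hp e e'
      have : (κ - s) * (p - q) = 0 := by linear_combination e - e'
      rcases mul_eq_zero.1 this with h | h
      · exfalso
        have hs : κ = s := sub_eq_zero.1 h
        rw [← hs] at e
        have : κ * (b - a) = 0 := by linear_combination -e
        exact mul_ne_zero hκ0 hd this
      · exact sub_eq_zero.1 h
    have hnum : ∀ p ∈ A, κ * (p - b) + t1 * (p - a) ≠ 0 := by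
      intro p hp h0
      have := uniq (-t1) p1 p p1a E1 (by linear_combination h0)
      rw [this] at h1A; exact h1A hp
    have hden : ∀ p ∈ A, κ * (p - b) - t2 * (p - a) ≠ 0 := by
      intro p hp h0
      have := uniq t2 p2 p p2a E2 (by linear_combination h0)
      rw [this] at h2A; exact h2A hp
    set H : ℂ → ℝ := fun p => ((κ * (p - b) + t1 * (p - a)) / (κ * (p - b) - t2 * (p - a))).re
    have Hc : ContinuousOn H A := by
      refine Complex.continuous_re.comp_continuousOn (ContinuousOn.div (by fun_prop) (by fun_prop) hden)
    have Ha : H a = 1 := by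
      have := hden a ha
      simp only [H, sub_self, mul_zero, add_zero, sub_zero] at this ⊢
      rw [div_self this]; simp
    have Hb : H b = -(t1 / t2) := by
      simp only [H, sub_self, mul_zero, zero_add, zero_sub]
      have ht2c : (t2 : ℂ) ≠ 0 := by exact_mod_cast ht2'.ne'
      have : (t1 * (b - a)) / (-(t2 * (b - a))) = ((-(t1 / t2) : ℝ) : ℂ) := by
        push_cast
        field_simp
      rw [this, Complex.ofReal_re]
    have hiv := hA.intermediate_value hb ha Hc
    have h0 : (0 : ℝ) ∈ Set.Icc (H b) (H a) := by
      rw [Ha, Hb]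
      constructor
      · have : 0 < t1 / t2 := by positivity
        linarith
      · norm_num
    obtain ⟨p, hp, hHp⟩ := hiv h0
    by_cases hpa : p = a
    · rw [hpa, Ha] at hHp; norm_num at hHp
    · obtain ⟨r, hr⟩ := hreal p hp hpa
      have hpn : p - a ≠ 0 := sub_ne_zero.2 hpa
      have n1 := hnum p hp
      have n2 := hden p hp
      have : (κ * (p - b) + t1 * (p - a)) / (κ * (p - b) - t2 * (p - a)) =
          (((r + t1) / (r - t2) : ℝ) : ℂ) := by
        rw [hr] at n2 ⊢
        rw [← sub_mul] at n2 ⊢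
        rw [← add_mul, mul_div_mul_right _ _ hpn]
        push_cast; rfl
      have h3 : (r + t1) / (r - t2) = 0 := by
        have : H p = (r + t1) / (r - t2) := by
          simp only [H]; rw [this, Complex.ofReal_re]
        rw [← this, hHp]
      apply div_ne_zero n1 n2
      rw [this, h3]; simp
  have fin : ∀ c : ℂ, c ≠ 0 → Arc a b c ⊆ A → c ∈ slitPlane := by
    intro c hc0 hcA
    by_contra hcs
    exact arc_unbounded hab hc0 hcs (hB.subset hcA)
  rcases hor with h | h
  · exact ⟨κ, fin _ hκ0 h, h⟩
  · exact ⟨-κ, fin _ (neg_ne_zero.2 hκ0) h, h⟩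

end SC

namespace SC
open Complex Topology Filter

/-- Euclidean three-space. -/
abbrev E3 : Type := EuclideanSpace ℝ (Fin 3)

theorem inner3 (x y : E3) : inner ℝ x y = x 0 * y 0 + x 1 * y 1 + x 2 * y 2 := by
  rw [PiLp.inner_apply, Fin.sum_univ_three]
  simp [mul_comm]

theorem normsq3 (x : E3) : ‖x‖ ^ 2 = x 0 ^ 2 + x 1 ^ 2 + x 2 ^ 2 := by
  rw [← real_inner_self_eq_norm_sq, inner3]; ring

theorem stereo (o w : E3) {R : ℝ} (hR : 0 < R) (hw : ‖w‖ = 1) : ∃ st : E3 → ℂ,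
    ContinuousOn st {x | dist x o = R ∧ x ≠ o + R • w} ∧
    InjOn st {x | dist x o = R ∧ x ≠ o + R • w} ∧
    ∀ (ν : E3) (δ : ℝ), inner ℝ ν (o + R • w) ≠ δ → ∃ α β1 β2 γ : ℝ, α ≠ 0 ∧
      ∀ x, dist x o = R → x ≠ o + R • w → inner ℝ ν x = δ →
        α * ((st x).re ^ 2 + (st x).im ^ 2) + β1 * (st x).re + β2 * (st x).im + γ = 0 := by
  obtain ⟨b, hb⟩ := Orthonormal.exists_orthonormalBasis_extension_of_card_eq (𝕜 := ℝ) (E := E3)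
    (ι := Fin 3) (by simp) (v := fun _ => w) (s := {2}) (by
      constructor
      · rintro ⟨i, hi⟩; simpa using hw
      · rintro ⟨i, hi⟩ ⟨j, hj⟩ hij
        exact absurd (Subtype.ext ((mem_singleton_iff.1 hi).trans (mem_singleton_iff.1 hj).symm)) hij)
  have hb2 : b 2 = w := hb 2 rfl
  set X : E3 → ℝ := fun x => inner ℝ (b 0) (x - o) with hX
  set Y : E3 → ℝ := fun x => inner ℝ (b 1) (x - o) with hY
  set Z : E3 → ℝ := fun x => inner ℝ (b 2) (x - o) with hZ
  have hsq : ∀ x, dist x o = R → X x ^ 2 + Y x ^ 2 + Z x ^ 2 = R ^ 2 := by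
    intro x hx
    have := b.sum_sq_norm_inner_right (x - o)
    rw [Fin.sum_univ_three, ← dist_eq_norm, hx] at this
    simpa using this
  have hdec : ∀ x, x - o = X x • b 0 + Y x • b 1 + Z x • b 2 := by
    intro x
    have := b.sum_repr' (x - o)
    rw [Fin.sum_univ_three] at this
    exact this.symm
  have hZne : ∀ x, dist x o = R → x ≠ o + R • w → R - Z x ≠ 0 := by
    intro x hx hxN h0
    have hZ' : Z x = R := by linarith
    have h1 := hsq x hx
    rw [hZ'] at h1
    have hX0 : X x = 0 := by nlinarith [sq_nonneg (X x), sq_nonneg (Y x)]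
    have hY0 : Y x = 0 := by nlinarith [sq_nonneg (X x), sq_nonneg (Y x)]
    have := hdec x
    rw [hX0, hY0, hZ', hb2] at this
    apply hxN
    rw [← sub_eq_iff_eq_add', this]; simp
  have hXc : Continuous X := by fun_prop
  have hYc : Continuous Y := by fun_prop
  have hZc : Continuous Z := by fun_prop
  refine ⟨fun x => ((X x / (R - Z x) : ℝ) : ℂ) + ((Y x / (R - Z x) : ℝ) : ℂ) * I, ?_, ?_, ?_⟩
  · have h1 : ContinuousOn (fun x => X x / (R - Z x)) {x | dist x o = R ∧ x ≠ o + R • w} :=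
      ContinuousOn.div hXc.continuousOn (by fun_prop) fun x hx => hZne x hx.1 hx.2
    have h2 : ContinuousOn (fun x => Y x / (R - Z x)) {x | dist x o = R ∧ x ≠ o + R • w} :=
      ContinuousOn.div hYc.continuousOn (by fun_prop) fun x hx => hZne x hx.1 hx.2
    exact (Complex.continuous_ofReal.comp_continuousOn h1).add
      ((Complex.continuous_ofReal.comp_continuousOn h2).mul continuousOn_const)
  · rintro x ⟨hx, hxN⟩ y ⟨hy, hyN⟩ hxy
    have n1 := hZne x hx hxN
    have n2 := hZne y hy hyN
    have s1 := hsq x hx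
    have s2 := hsq y hy
    have e1 : X x / (R - Z x) = X y / (R - Z y) := by
      have := congrArg re hxy
      simp only [add_re, ofReal_re, mul_re, I_re, mul_zero, ofReal_im, I_im, mul_one, sub_self,
        add_zero, add_im, mul_im, zero_add] at this
      exact this
    have e2 : Y x / (R - Z x) = Y y / (R - Z y) := by
      have := congrArg im hxy
      simp only [add_re, ofReal_re, mul_re, I_re, mul_zero, ofReal_im, I_im, mul_one, sub_self,
        add_zero, add_im, mul_im, zero_add] at this
      exact this
    have q : ∀ x, R - Z x ≠ 0 → X x ^ 2 + Y x ^ 2 + Z x ^ 2 = R ^ 2 →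
        (X x / (R - Z x)) ^ 2 + (Y x / (R - Z x)) ^ 2 = 2 * R / (R - Z x) - 1 := by
      intro x h s
      field_simp
      linarith
    have e3 : 2 * R / (R - Z x) = 2 * R / (R - Z y) := by
      have := q x n1 s1; have := q y n2 s2
      rw [e1, e2] at *
      linarith
    have e4 : R - Z x = R - Z y := by
      field_simp at e3
      linarith
    rw [e4] at e1 e2
    have e1' : X x = X y := by field_simp at e1; exact e1
    have e2' : Y x = Y y := by field_simp at e2; exact e2
    have e3' : Z x = Z y := by linarith
    have := hdec x
    rw [e1', e2', e3', ← hdec y] at this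
    simpa using this
  · intro ν δ hνδ
    set n0 := (inner ℝ ν (b 0) : ℝ)
    set n1 := (inner ℝ ν (b 1) : ℝ)
    set n2 := (inner ℝ ν (b 2) : ℝ)
    set d : ℝ := δ - inner ℝ ν o with hd
    have hNd : n2 * R ≠ d := by
      intro h; apply hνδ
      rw [inner_add_right, inner_smul_right, ← hb2]
      change _ + R * n2 = δ
      linarith
    refine ⟨n2 * R - d, 2 * R * n0, 2 * R * n1, -n2 * R - d, sub_ne_zero.2 hNd, ?_⟩
    intro x hx hxN hxν
    have n3 := hZne x hx hxN
    have s1 := hsq x hx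
    have hpl : n0 * X x + n1 * Y x + n2 * Z x = d := by
      have h1 : inner ℝ ν (x - o) = d := by rw [inner_sub_right, hxν]
      rw [hdec x, inner_add_right, inner_add_right, inner_smul_right, inner_smul_right,
        inner_smul_right] at h1
      linarith
    simp only [add_re, ofReal_re, mul_re, I_re, mul_zero, ofReal_im, I_im, mul_one, sub_self,
      add_zero, add_im, mul_im, zero_add]
    have q : (X x / (R - Z x)) ^ 2 + (Y x / (R - Z x)) ^ 2 = (R + Z x) / (R - Z x) := by
      field_simp
      linarith
    rw [q]
    field_simp
    linear_combination (2 * R) * hpl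

theorem exists_pole {ι : Type*} (s : Finset ι) (o : E3) {R : ℝ} (hR : 0 < R) (ν : ι → E3)
    (δ : ι → ℝ) (hν : ∀ i ∈ s, ν i ≠ 0) :
    ∃ w : E3, ‖w‖ = 1 ∧ ∀ i ∈ s, inner ℝ (ν i) (o + R • w) ≠ δ i := by
  classical
  let d : ι → ℝ := fun i => (δ i - inner ℝ (ν i) o) / R
  let P : ι → Polynomial ℝ := fun i =>
    Polynomial.C (-ν i 2 - d i) + Polynomial.C (2 * ν i 0) * Polynomial.X +
    Polynomial.C (ν i 2 - d i) * Polynomial.X ^ 2 + Polynomial.C (2 * ν i 1) * Polynomial.X ^ 3 +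
    Polynomial.C (ν i 2 - d i) * Polynomial.X ^ 6
  have hP : ∀ i ∈ s, P i ≠ 0 := by
    intro i hi h0
    have c0 := congrArg (fun p => Polynomial.coeff p 0) h0
    have c1 := congrArg (fun p => Polynomial.coeff p 1) h0
    have c2 := congrArg (fun p => Polynomial.coeff p 2) h0
    have c3 := congrArg (fun p => Polynomial.coeff p 3) h0
    simp only [P, Polynomial.coeff_add, Polynomial.coeff_C_mul, Polynomial.coeff_C,
      Polynomial.coeff_X, Polynomial.coeff_X_pow, Polynomial.coeff_zero] at c0 c1 c2 c3
    norm_num at c0 c1 c2 c3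
    apply hν i hi
    ext j
    fin_cases j
    · simpa using c1
    · simpa using c3
    · simp; linarith
  have hprod : (∏ i ∈ s, P i) ≠ 0 := Finset.prod_ne_zero_iff.2 hP
  obtain ⟨t, ht⟩ : ∃ t : ℝ, (∏ i ∈ s, P i).eval t ≠ 0 := by
    by_contra hcon
    push Not at hcon
    exact hprod (Polynomial.funext (by simpa using hcon))
  rw [Polynomial.eval_prod, Finset.prod_ne_zero_iff] at ht
  have hD : 0 < 1 + t ^ 2 + t ^ 6 := by positivity
  refine ⟨!₂[2 * t / (1 + t ^ 2 + t ^ 6), 2 * t ^ 3 / (1 + t ^ 2 + t ^ 6),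
    (t ^ 2 + t ^ 6 - 1) / (1 + t ^ 2 + t ^ 6)], ?_, ?_⟩
  · rw [← sq_eq_sq₀ (norm_nonneg _) zero_le_one, normsq3]
    simp
    field_simp
    ring
  · intro i hi h
    apply ht i hi
    rw [inner_add_right, inner_smul_right, inner3 _ (!₂[_, _, _])] at h
    simp at h
    simp [P]
    have hd : d i * R = δ i - inner ℝ (ν i) o := by simp only [d]; field_simp
    field_simp at h
    apply mul_left_cancel₀ hR.ne'
    linear_combination h - (1 + t ^ 2 + t ^ 6) * hd

theorem circle_normal {C : Set E3} (h : IsCircle 3 C) :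
    ∃ (ν : E3) (δ : ℝ), ν ≠ 0 ∧ ∀ x ∈ C, inner ℝ ν x = δ := by
  obtain ⟨P, c, r, hP, hc, hr, rfl⟩ := h
  have h1 : P.directionᗮ ≠ ⊥ := by
    intro h
    have := Submodule.finrank_add_finrank_orthogonal P.direction
    rw [h, hP] at this
    simp at this
  obtain ⟨ν, hν, hν0⟩ := Submodule.exists_mem_ne_zero_of_ne_bot h1
  refine ⟨ν, inner ℝ ν c, hν0, ?_⟩
  rintro x ⟨hx, -⟩
  rw [← sub_eq_zero, ← inner_sub_right]
  rw [real_inner_comm]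
  exact (Submodule.mem_orthogonal _ _).1 hν _ (AffineSubspace.vsub_mem_direction hx hc)

theorem sphere3 {S : Set E3} (h : IsSphereDim 3 2 S) :
    ∃ (o : E3) (R : ℝ), 0 < R ∧ S = {x | dist x o = R} := by
  obtain ⟨P, c, r, hP, hc, hr, rfl⟩ := h
  refine ⟨c, r, hr, ?_⟩
  have h1 : P.direction = ⊤ := Submodule.eq_top_of_finrank_eq (by rw [hP]; simp)
  have h2 : P = ⊤ := by
    rwa [AffineSubspace.direction_eq_top_iff_of_nonempty ⟨c, hc⟩] at h1
  ext x; simp [h2]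

theorem circle_subset_sphere {C S : Set E3} (hC : IsCircle 3 C) (hS : IsSphereDim 3 2 S)
    (hinf : (C ∩ S).Infinite) : C ⊆ S := by
  obtain ⟨o, R, hR, rfl⟩ := sphere3 hS
  obtain ⟨P, c, r, hP, hc, hr, rfl⟩ := hC
  obtain ⟨f, hf⟩ := hinf.exists_subset_card_eq 3
  obtain ⟨x, y, z, hxy, hxz, hyz, rfl⟩ := Finset.card_eq_three.1 hf.2
  simp only [Finset.coe_insert, Finset.coe_singleton, Set.insert_subset_iff,
    Set.singleton_subset_iff] at hf
  obtain ⟨⟨⟨⟨hxP, hxc⟩, hxo⟩, ⟨⟨hyP, hyc⟩, hyo⟩, ⟨⟨hzP, hzc⟩, hzo⟩⟩, -⟩ := hf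
  simp only [mem_ofPred_eq] at hxo hyo hzo
  have hcos : EuclideanGeometry.Cospherical ({x, y, z} : Set E3) := ⟨c, r, by simp [hxc, hyc, hzc]⟩
  have hai := hcos.affineIndependent_of_ne hxy hxz hyz
  have hspan : affineSpan ℝ (Set.range ![x, y, z]) = P := by
    apply hai.affineSpan_eq_of_le_of_card_eq_finrank_add_one
    · rw [affineSpan_le]
      rintro _ ⟨i, rfl⟩
      fin_cases i
      · exact hxP
      · exact hyP
      · exact hzP
    · simp [hP]
  have key : ∀ u : E3, dist u o ^ 2 = dist u c ^ 2 + 2 * inner ℝ (c - o) (u - c) + ‖c - o‖ ^ 2 := by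
    intro u
    rw [dist_eq_norm, dist_eq_norm]
    have : u - o = (u - c) + (c - o) := by abel
    rw [this, norm_add_sq_real, real_inner_comm]
  have hle : P ≤ AffineSubspace.mk' x (ℝ ∙ (c - o))ᗮ := by
    rw [← hspan, affineSpan_le]
    have kx := key x
    rw [hxo, hxc] at kx
    rintro _ ⟨i, rfl⟩
    fin_cases i
    · exact AffineSubspace.self_mem_mk' _ _
    · change y ∈ AffineSubspace.mk' x (ℝ ∙ (c - o))ᗮ
      rw [AffineSubspace.mem_mk', Submodule.mem_orthogonal_singleton_iff_inner_right]
      have k := key y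
      rw [hyo, hyc] at k
      have : y -ᵥ x = (y - c) - (x - c) := by simp
      rw [this, inner_sub_right]; linarith
    · change z ∈ AffineSubspace.mk' x (ℝ ∙ (c - o))ᗮ
      rw [AffineSubspace.mem_mk', Submodule.mem_orthogonal_singleton_iff_inner_right]
      have k := key z
      rw [hzo, hzc] at k
      have : z -ᵥ x = (z - c) - (x - c) := by simp
      rw [this, inner_sub_right]; linarith
  rintro u ⟨huP, huc⟩
  have hu := hle huP
  rw [AffineSubspace.mem_mk', Submodule.mem_orthogonal_singleton_iff_inner_right] at hu
  have : u -ᵥ x = (u - c) - (x - c) := by simp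
  rw [this, inner_sub_right] at hu
  have kx := key x
  rw [hxo, hxc] at kx
  have ku := key u
  rw [huc] at ku
  change dist u o = R
  rw [← sq_eq_sq₀ dist_nonneg hR.le]
  linarith

end SC

namespace SC
open Complex Topology Filter

theorem edges_on_sphere {n : ℕ} (hn : 3 ≤ n) (D : CircularArcDrawing 3 (⊤ : SimpleGraph (Fin n)))
    {S : Set E3} (hS : IsSphereDim 3 2 S) (T : Finset (Sym2 (Fin n)))
    (hT : ∀ e ∈ T, e ∈ (⊤ : SimpleGraph (Fin n)).edgeSet ∧ D.arc e ⊆ S) :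
    T.card + 6 ≤ 3 * n := by
  classical
  obtain ⟨o, R, hR, rfl⟩ := sphere3 hS
  have hTe : ∀ e : T, e.1 ∈ (⊤ : SimpleGraph (Fin n)).edgeSet := fun e => (hT e.1 e.2).1
  have hcirc : ∀ e : T, ∃ (ν : E3) (δ : ℝ), ν ≠ 0 ∧ ∀ x ∈ D.arc e.1, inner ℝ ν x = δ := by
    intro e
    obtain ⟨C, hC, hAC, -⟩ := D.arc_isArc _ (hTe e)
    obtain ⟨ν, δ, h0, h⟩ := circle_normal hC
    exact ⟨ν, δ, h0, fun x hx => h x (hAC hx)⟩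
  choose ν δ hν0 hν using hcirc
  obtain ⟨w, hw, hpole⟩ := exists_pole (Finset.univ : Finset T) o hR ν δ (fun i _ => hν0 i)
  obtain ⟨st, hstc, hsti, hstq⟩ := stereo o w hR hw
  have hdom : ∀ e : T, D.arc e.1 ⊆ {x | dist x o = R ∧ x ≠ o + R • w} := by
    intro e x hx
    refine ⟨(hT e.1 e.2).2 hx, ?_⟩
    rintro rfl
    exact hpole e (Finset.mem_univ _) (hν e _ hx)
  have hst : ∀ e : T, ∃ p : Fin n × Fin n, e.1 = s(p.1, p.2) := by
    rintro ⟨e, he⟩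
    induction e using Sym2.ind with
    | _ x y => exact ⟨(x, y), rfl⟩
  choose P hP using hst
  have hne : ∀ e : T, (P e).1 ≠ (P e).2 := by
    intro e
    have := hTe e
    rw [hP e] at this
    simpa using this
  have hm1 : ∀ e : T, D.pos (P e).1 ∈ D.arc e.1 := fun e =>
    D.endpoint_mem _ (hTe e) _ (by rw [hP e]; simp)
  have hm2 : ∀ e : T, D.pos (P e).2 ∈ D.arc e.1 := fun e =>
    D.endpoint_mem _ (hTe e) _ (by rw [hP e]; simp)
  set pos : Fin n → ℂ := fun v => st (D.pos v) with hpos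
  have hab : ∀ e : T, pos (P e).1 ≠ pos (P e).2 := by
    intro e h
    exact hne e (D.inj (hsti (hdom e (hm1 e)) (hdom e (hm2 e)) h))
  have harc : ∀ e : T, ∃ c ∈ slitPlane, Arc (pos (P e).1) (pos (P e).2) c ⊆ st '' D.arc e.1 := by
    intro e
    obtain ⟨C, hC, hAC, hcomp, hconn⟩ := D.arc_isArc _ (hTe e)
    have hc := hstc.mono (hdom e)
    obtain ⟨α, β1, β2, γ, hα, hq⟩ := hstq (ν e) (δ e) (hpole e (Finset.mem_univ _))
    refine trim (hconn.isPreconnected.image _ hc) (hcomp.image_of_continuousOn hc).isBounded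
      (mem_image_of_mem _ (hm1 e)) (mem_image_of_mem _ (hm2 e)) (hab e) (α := α) (β1 := β1)
      (β2 := β2) (γ := γ) (Or.inl hα) ?_
    rintro _ ⟨x, hx, rfl⟩
    exact hq x (hdom e hx).1 (hdom e hx).2 (hν e x hx)
  choose c hc hcA using harc
  have hpull : ∀ e : T, ∀ x, (∃ e' : T, x ∈ D.arc e'.1) →
      st x ∈ Arc (pos (P e).1) (pos (P e).2) (c e) → x ∈ D.arc e.1 := by
    rintro e x ⟨e', he'⟩ h
    obtain ⟨y, hy, hyx⟩ := hcA e h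
    rwa [← hsti (hdom e hy) (hdom e' he') hyx]
  have := planar_bound (E := T) (V := Fin n) (src := fun e => (P e).1) (tgt := fun e => (P e).2)
    (pos := pos) (c := c) hc hab ?_ ?_ (by simpa using hn)
  · simpa using this
  · intro e e' hee' p hp h1 h2 hp'
    obtain ⟨x, hx, rfl⟩ := hcA e hp
    have hx' := hpull e' x ⟨e, hx⟩ hp'
    have hin : x ∈ D.arc e.1 ∩ D.arc e'.1 := ⟨hx, hx'⟩
    rw [D.crossFree _ (hTe e) _ (hTe e') (fun h => hee' (Subtype.ext h))] at hin
    obtain ⟨v, ⟨hv, -⟩, rfl⟩ := hin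
    rw [hP e, Sym2.mem_iff] at hv
    rcases hv with rfl | rfl
    · exact h1 rfl
    · exact h2 rfl
  · intro e e' hee'
    by_contra hcon
    push Not at hcon
    have g1 := D.vertex_mem _ (hTe e') _ (hpull e' _ ⟨e, hm1 e⟩ hcon.1)
    have g2 := D.vertex_mem _ (hTe e') _ (hpull e' _ ⟨e, hm2 e⟩ hcon.2)
    apply hee'
    apply Subtype.ext
    rw [hP e]
    exact ((Sym2.mem_and_mem_iff (hne e)).1 ⟨g1, g2⟩).symm

theorem lower {n : ℕ} (hn : 3 ≤ n) (D : CircularArcDrawing 3 (⊤ : SimpleGraph (Fin n)))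
    (𝒮 : Finset (Set E3)) (h : D.ArcsInSpheres 𝒮) : (n + 7) / 6 ≤ 𝒮.card := by
  classical
  obtain ⟨hS, hcov⟩ := h
  have hone : ∀ e ∈ (⊤ : SimpleGraph (Fin n)).edgeSet, ∃ S ∈ 𝒮, D.arc e ⊆ S := by
    intro e he
    obtain ⟨C, hC, hAC, hcomp, hconn⟩ := D.arc_isArc _ he
    have hinf : (D.arc e).Infinite := by
      apply hconn.isPreconnected.infinite_of_nontrivial
      induction e using Sym2.ind with
      | _ x y =>
        refine ⟨D.pos x, D.endpoint_mem _ he _ (by simp), D.pos y, D.endpoint_mem _ he _ (by simp), ?_⟩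
        exact fun h => (by simpa using he : x ≠ y) (D.inj h)
    by_contra hcon
    push Not at hcon
    apply hinf
    have : D.arc e ⊆ ⋃ S ∈ 𝒮, (D.arc e ∩ S) := by
      intro x hx
      obtain ⟨S, hS1, hxS⟩ := mem_iUnion₂.1 (hcov e he hx)
      exact mem_iUnion₂.2 ⟨S, hS1, hx, hxS⟩
    refine Set.Finite.subset (Set.Finite.biUnion 𝒮.finite_toSet ?_) this
    intro S hS1
    by_contra hfin
    apply hcon S hS1
    exact hAC.trans (circle_subset_sphere hC (hS S hS1)
      (Set.Infinite.mono (inter_subset_inter_left _ hAC) hfin))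
  have hsub : (⊤ : SimpleGraph (Fin n)).edgeFinset ⊆
      𝒮.biUnion fun S => (⊤ : SimpleGraph (Fin n)).edgeFinset.filter fun e => D.arc e ⊆ S := by
    intro e he
    obtain ⟨S, hS1, hS2⟩ := hone e (SimpleGraph.mem_edgeFinset.1 he)
    exact Finset.mem_biUnion.2 ⟨S, hS1, Finset.mem_filter.2 ⟨he, hS2⟩⟩
  have h1 := Finset.card_le_card hsub
  have h2 := Finset.card_biUnion_le_card_mul 𝒮
    (fun S => (⊤ : SimpleGraph (Fin n)).edgeFinset.filter fun e => D.arc e ⊆ S) (3 * n - 6) (by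
      intro S hS1
      have := edges_on_sphere hn D (hS S hS1)
        ((⊤ : SimpleGraph (Fin n)).edgeFinset.filter fun e => D.arc e ⊆ S) (by
          intro e he
          rw [Finset.mem_filter, SimpleGraph.mem_edgeFinset] at he
          exact he)
      omega)
  have h3 : (⊤ : SimpleGraph (Fin n)).edgeFinset.card = n.choose 2 := by
    rw [SimpleGraph.card_edgeFinset_top_eq_card_choose_two, Fintype.card_fin]
  have h4 : n.choose 2 ≤ 𝒮.card * (3 * n - 6) := by rw [← h3]; exact h1.trans h2
  rw [Nat.choose_two_right] at h4
  have h5 : n * (n - 1) = 2 * (n * (n - 1) / 2) := by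
    have := Nat.even_mul_pred_self n
    exact (Nat.two_mul_div_two_of_even this).symm
  obtain ⟨m, rfl⟩ : ∃ m, n = m + 3 := ⟨n - 3, by omega⟩
  have h6 : (m + 3) * (m + 2) ≤ 2 * (𝒮.card * (3 * m + 3)) := by
    have e1 : m + 3 - 1 = m + 2 := by omega
    have e2 : 3 * (m + 3) - 6 = 3 * m + 3 := by omega
    rw [e1] at h5 h4
    rw [e2] at h4
    omega
  by_contra hlt
  push Not at hlt
  have h7 : 6 * 𝒮.card ≤ m + 4 := by omega
  nlinarith

end SC

namespace SC
open Topology Filter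

/-- Point of the unit circle with rational parameter `u`. -/
def cpt (u : ℝ) : E3 := !₂[(1 - u ^ 2) / (1 + u ^ 2), 2 * u / (1 + u ^ 2), 0]

theorem cpt_inj : Function.Injective cpt := by
  intro u v h
  have h0 := congrArg (fun p : E3 => p 0) h
  have h1 := congrArg (fun p : E3 => p 1) h
  simp [cpt] at h0 h1
  have hu : 0 < 1 + u ^ 2 := by positivity
  have hv : 0 < 1 + v ^ 2 := by positivity
  field_simp at h0 h1
  have : u ^ 2 = v ^ 2 := by linarith
  rw [this] at h1
  have := mul_left_cancel₀ hv.ne' (by linarith : (1 + v ^ 2) * u = (1 + v ^ 2) * v)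
  exact this

/-- Radius variable. -/
def rho (s t τ : ℝ) : ℝ := √((τ - s) * (t - τ))

/-- Denominator. -/
def Gd (h ε s t τ : ℝ) : ℝ := (1 + τ ^ 2 + rho s t τ ^ 2) / 2 - ε * h * rho s t τ / √(1 + h ^ 2)

/-- Parametrization of an edge. -/
def curve (h ε s t τ : ℝ) : E3 :=
  !₂[(1 - τ ^ 2 - rho s t τ ^ 2) / (2 * Gd h ε s t τ), τ / Gd h ε s t τ,
    ε * rho s t τ / (√(1 + h ^ 2) * Gd h ε s t τ)]

/-- Arc representing an edge. -/
def arcE (h ε s t : ℝ) : Set E3 := curve h ε s t '' Icc s t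

theorem Gd_pos {h ε s t τ : ℝ} (hh : 0 ≤ h) (hε : ε = 1 ∨ ε = -1) : 0 < Gd h ε s t τ := by
  have hK : 0 < √(1 + h ^ 2) := Real.sqrt_pos.2 (by positivity)
  have hhK : h < √(1 + h ^ 2) := Real.lt_sqrt_of_sq_lt (by linarith)
  have hρ : 0 ≤ rho s t τ := Real.sqrt_nonneg _
  have h1 : ε * h * rho s t τ / √(1 + h ^ 2) ≤ rho s t τ := by
    rw [div_le_iff₀ hK]
    rcases hε with rfl | rfl <;> nlinarith
  unfold Gd
  have h2 : rho s t τ ≤ (1 + rho s t τ ^ 2) / 2 := by nlinarith [sq_nonneg (rho s t τ - 1)]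
  rcases hρ.eq_or_lt with h0 | h0
  · rw [← h0]; simp; positivity
  · have h3 : ε * h * rho s t τ / √(1 + h ^ 2) < rho s t τ := by
      rw [div_lt_iff₀ hK]
      have : h * rho s t τ < rho s t τ * √(1 + h ^ 2) := by nlinarith
      rcases hε with rfl | rfl
      · linarith
      · have : 0 ≤ h * rho s t τ := by positivity
        linarith
    nlinarith [sq_nonneg τ]

theorem continuous_curve {h ε s t : ℝ} (hh : 0 ≤ h) (hε : ε = 1 ∨ ε = -1) :
    Continuous (curve h ε s t) := by
  have hK : 0 < √(1 + h ^ 2) := Real.sqrt_pos.2 (by positivity)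
  have hρ : Continuous (rho s t) := by unfold rho; fun_prop
  have hG : Continuous (Gd h ε s t) := by unfold Gd; fun_prop
  have hG0 : ∀ τ, Gd h ε s t τ ≠ 0 := fun τ => (Gd_pos hh hε).ne'
  unfold curve
  refine (PiLp.continuous_toLp 2 _).comp (continuous_pi ?_)
  intro i
  fin_cases i
  · exact Continuous.div (by fun_prop) (by fun_prop) fun τ => mul_ne_zero two_ne_zero (hG0 τ)
  · exact Continuous.div (by fun_prop) (by fun_prop) fun τ => hG0 τ
  · exact Continuous.div (by fun_prop) (by fun_prop) fun τ => mul_ne_zero hK.ne' (hG0 τ)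

theorem arcE_facts {h ε s t : ℝ} (hh : 0 ≤ h) (hε : ε = 1 ∨ ε = -1) {x : E3}
    (hx : x ∈ arcE h ε s t) :
    x 0 ^ 2 + x 1 ^ 2 + x 2 ^ 2 - 2 * h * x 2 = 1 ∧
    (1 + h * x 2 - x 0) - (s + t) * x 1 + s * t * (1 + h * x 2 + x 0) = 0 ∧
    0 ≤ ε * x 2 ∧ 0 < 1 + h * x 2 + x 0 ∧ s * (1 + h * x 2 + x 0) ≤ x 1 ∧
    x 1 ≤ t * (1 + h * x 2 + x 0) := by
  obtain ⟨τ, ⟨h1, h2⟩, rfl⟩ := hx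
  have hK : 0 < √(1 + h ^ 2) := Real.sqrt_pos.2 (by positivity)
  have hKs : √(1 + h ^ 2) ^ 2 = 1 + h ^ 2 := Real.sq_sqrt (by positivity)
  have hG := Gd_pos (s := s) (t := t) (τ := τ) hh hε
  have hρ : 0 ≤ rho s t τ := Real.sqrt_nonneg _
  have hρs : rho s t τ ^ 2 = (τ - s) * (t - τ) :=
    Real.sq_sqrt (mul_nonneg (by linarith) (by linarith))
  have hεs : ε ^ 2 = 1 := by rcases hε with rfl | rfl <;> norm_num
  have hGd : Gd h ε s t τ = (1 + τ ^ 2 + rho s t τ ^ 2) / 2 - ε * h * rho s t τ / √(1 + h ^ 2) := rfl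
  simp only [curve]
  simp only [Matrix.cons_val_zero, Matrix.cons_val_one, Matrix.cons_val]
  set G := Gd h ε s t τ
  set K := √(1 + h ^ 2)
  set ρ := rho s t τ
  have e1 : 1 + h * (ε * ρ / (K * G)) = (1 + τ ^ 2 + ρ ^ 2) / (2 * G) := by
    field_simp
    field_simp at hGd
    linear_combination hGd
  have eA : 1 + h * (ε * ρ / (K * G)) + (1 - τ ^ 2 - ρ ^ 2) / (2 * G) = 1 / G := by
    rw [e1]; field_simp; ring
  have ez : (ε * ρ / (K * G)) ^ 2 * (1 + h ^ 2) = ρ ^ 2 / G ^ 2 := by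
    rw [← hKs]; field_simp; rw [hεs, one_mul]
  refine ⟨?_, ?_, ?_, ?_, ?_, ?_⟩
  · have : (1 + h * (ε * ρ / (K * G))) ^ 2 - ((1 - τ ^ 2 - ρ ^ 2) / (2 * G)) ^ 2 - (τ / G) ^ 2 =
        ρ ^ 2 / G ^ 2 := by
      rw [e1]; field_simp; ring
    linear_combination ez - this
  · rw [eA, e1]
    field_simp
    rw [hρs]; ring
  · rw [← mul_div_assoc, ← mul_assoc, ← sq, hεs]; positivity
  · rw [eA]; positivity
  · rw [eA, mul_one_div]; gcongr
  · rw [eA, mul_one_div]; gcongr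

theorem arcE_prod {h ε s t : ℝ} (hh : 0 ≤ h) (hε : ε = 1 ∨ ε = -1) {x : E3}
    (hx : x ∈ arcE h ε s t) :
    (x 1 - s * (1 + h * x 2 + x 0)) * (t * (1 + h * x 2 + x 0) - x 1) = x 2 ^ 2 * (1 + h ^ 2) := by
  obtain ⟨h1, h2, -⟩ := arcE_facts hh hε hx
  linear_combination (1 + h * x 2 + x 0) * h2 * (-1) - h1

theorem arcE_zero {h ε s t : ℝ} (hh : 0 ≤ h) (hε : ε = 1 ∨ ε = -1) {x : E3}
    (hx : x ∈ arcE h ε s t) (hz : x 2 = 0) : x = cpt s ∨ x = cpt t := by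
  have hp := arcE_prod hh hε hx
  obtain ⟨h1, h2, -, h4, -⟩ := arcE_facts hh hε hx
  rw [hz] at hp h1 h2 h4
  simp at hp h1 h4
  have key : ∀ u : ℝ, x 1 = u * (1 + x 0) → x = cpt u := by
    intro u hu
    have hu1 : 0 < 1 + u ^ 2 := by positivity
    rw [hu] at h1
    have h5 : (1 + x 0) * ((1 - x 0) - u ^ 2 * (1 + x 0)) = 0 := by linear_combination -h1
    have h6 : (1 - x 0) - u ^ 2 * (1 + x 0) = 0 := by
      rcases mul_eq_zero.1 h5 with h | h
      · linarith
      · exact h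
    have h7 : x 0 = (1 - u ^ 2) / (1 + u ^ 2) := by
      rw [eq_div_iff hu1.ne']; linarith
    ext i
    fin_cases i
    · simpa [cpt] using h7
    · simp [cpt]
      rw [hu, h7]; field_simp; ring
    · simpa [cpt] using hz
  rcases hp with h | h
  · left; apply key; linarith
  · right; apply key; linarith

theorem cpt_left_mem {h ε s t : ℝ} (hst : s ≤ t) : cpt s ∈ arcE h ε s t := by
  refine ⟨s, ⟨le_rfl, hst⟩, ?_⟩
  have : rho s t s = 0 := by simp [rho]
  have hs : 0 < 1 + s ^ 2 := by positivity
  ext i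
  fin_cases i
  · simp [curve, cpt, Gd, this]; field_simp
  · simp [curve, cpt, Gd, this]; field_simp
  · simp [curve, cpt, Gd, this]

theorem cpt_right_mem {h ε s t : ℝ} (hst : s ≤ t) : cpt t ∈ arcE h ε s t := by
  refine ⟨t, ⟨hst, le_rfl⟩, ?_⟩
  have : rho s t t = 0 := by simp [rho]
  have hs : 0 < 1 + t ^ 2 := by positivity
  ext i
  fin_cases i
  · simp [curve, cpt, Gd, this]; field_simp
  · simp [curve, cpt, Gd, this]; field_simp
  · simp [curve, cpt, Gd, this]

/-- The spheres of the pencil through the unit circle. -/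
def sph (h : ℝ) : Set E3 := {x | dist x !₂[0, 0, h] = √(1 + h ^ 2)}

theorem mem_sph {h : ℝ} {x : E3} :
    x ∈ sph h ↔ x 0 ^ 2 + x 1 ^ 2 + x 2 ^ 2 - 2 * h * x 2 = 1 := by
  change dist x !₂[0, 0, h] = √(1 + h ^ 2) ↔ _
  rw [← sq_eq_sq₀ dist_nonneg (Real.sqrt_nonneg _), Real.sq_sqrt (by positivity), dist_eq_norm,
    normsq3]
  simp
  constructor <;> intro h <;> linarith

theorem isSphere_sph (h : ℝ) : IsSphereDim 3 2 (sph h) := by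
  refine ⟨⊤, !₂[0, 0, h], √(1 + h ^ 2), by rw [AffineSubspace.direction_top]; simp, trivial, Real.sqrt_pos.2 (by positivity), ?_⟩
  ext x; simp [sph]

theorem circle_of_plane {o ν : E3} {R δ : ℝ} (hν : ν ≠ 0) {x y : E3} (hxy : x ≠ y)
    (hx : dist x o = R) (hxν : inner ℝ ν x = δ) (hy : dist y o = R) (hyν : inner ℝ ν y = δ) :
    ∃ C, IsCircle 3 C ∧ ∀ z, dist z o = R → inner ℝ ν z = δ → z ∈ C := by
  have hνn : ‖ν‖ ^ 2 ≠ 0 := by simpa using hν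
  set k : ℝ := (δ - inner ℝ ν o) / ‖ν‖ ^ 2 with hk
  set c : E3 := o + k • ν with hc
  have hνc : inner ℝ ν c = δ := by
    rw [hc, inner_add_right, inner_smul_right, real_inner_self_eq_norm_sq, hk]
    field_simp; ring
  have hpy : ∀ z, dist z o = R → inner ℝ ν z = δ → dist z c ^ 2 = R ^ 2 - ‖c - o‖ ^ 2 := by
    intro z hz hzν
    have e1 : z - o = (z - c) + (c - o) := by abel
    have e2 : inner ℝ (z - c) (c - o) = 0 := by
      have : c - o = k • ν := by rw [hc]; abel
      rw [this, inner_smul_right, real_inner_comm, inner_sub_right, hzν, hνc]; simp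
    have := norm_add_sq_real (z - c) (c - o)
    rw [← e1, e2, ← dist_eq_norm, ← dist_eq_norm, hz] at this
    linarith
  have hdir : ∀ z, inner ℝ ν z = δ → z ∈ AffineSubspace.mk' c (ℝ ∙ ν)ᗮ := by
    intro z hz
    rw [AffineSubspace.mem_mk', Submodule.mem_orthogonal_singleton_iff_inner_right, vsub_eq_sub,
      inner_sub_right, hz, hνc, sub_self]
  refine ⟨{z | z ∈ AffineSubspace.mk' c (ℝ ∙ ν)ᗮ ∧ dist z c = dist x c},
    ⟨AffineSubspace.mk' c (ℝ ∙ ν)ᗮ, c, dist x c, ?_, AffineSubspace.self_mem_mk' _ _, ?_, rfl⟩, ?_⟩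
  · rw [AffineSubspace.direction_mk']
    have : Fact (Module.finrank ℝ E3 = 2 + 1) := ⟨by simp⟩
    exact Submodule.finrank_orthogonal_span_singleton hν
  · refine dist_pos.2 ?_
    intro h
    apply hxy
    have h1 := hpy x hx hxν
    have h2 := hpy y hy hyν
    rw [h, dist_self] at h1
    have : dist y c = 0 := by
      have : dist y c ^ 2 = 0 := by rw [h2, ← h1]; simp
      simpa using this
    rw [h, dist_eq_zero.1 this]
  · intro z hz hzν
    refine ⟨hdir z hzν, ?_⟩
    rw [← sq_eq_sq₀ dist_nonneg dist_nonneg, hpy z hz hzν, hpy x hx hxν]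

theorem isArc_arcE {h ε s t : ℝ} (hh : 0 ≤ h) (hε : ε = 1 ∨ ε = -1) (hst : s < t) :
    IsArc 3 (arcE h ε s t) := by
  have hpl : ∀ z ∈ arcE h ε s t,
      inner ℝ (!₂[s * t - 1, -(s + t), h * (1 + s * t)] : E3) z = -(1 + s * t) := by
    intro z hz
    obtain ⟨-, h2, -⟩ := arcE_facts hh hε hz
    rw [inner3]
    simp
    linear_combination h2
  have hsp : ∀ z ∈ arcE h ε s t, dist z !₂[0, 0, h] = √(1 + h ^ 2) := by
    intro z hz
    exact mem_sph.2 (arcE_facts hh hε hz).1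
  have hs := cpt_left_mem (h := h) (ε := ε) hst.le
  have ht := cpt_right_mem (h := h) (ε := ε) hst.le
  obtain ⟨C, hC, hsub⟩ := circle_of_plane (o := !₂[0, 0, h])
    (ν := !₂[s * t - 1, -(s + t), h * (1 + s * t)]) (R := √(1 + h ^ 2)) (δ := -(1 + s * t)) (by
      intro h0
      have h1 := congrArg (fun p : E3 => p 0) h0
      have h2 := congrArg (fun p : E3 => p 1) h0
      simp at h1 h2
      nlinarith [sq_nonneg s])
    (x := cpt s) (y := cpt t) (fun h => hst.ne (cpt_inj h)) (hsp _ hs) (hpl _ hs) (hsp _ ht)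
    (hpl _ ht)
  refine ⟨C, hC, fun z hz => hsub z (hsp z hz) (hpl z hz), ?_, ?_⟩
  · exact isCompact_Icc.image (continuous_curve hh hε)
  · exact (isConnected_Icc hst.le).image _ (continuous_curve hh hε).continuousOn

theorem arcE_cross {h ε s t h' ε' s' t' : ℝ} (hh : 0 ≤ h) (hε : ε = 1 ∨ ε = -1) (hh' : 0 ≤ h')
    (hε' : ε' = 1 ∨ ε' = -1)
    (hne : h = h' → ε = ε' → s < t' → s' < t →
      (s ≤ s' ∧ t' < t) ∨ (s < s' ∧ t' ≤ t) ∨ (s' ≤ s ∧ t < t') ∨ (s' < s ∧ t ≤ t'))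
    {x : E3} (hx : x ∈ arcE h ε s t) (hx' : x ∈ arcE h' ε' s' t') :
    (x = cpt s ∨ x = cpt t) ∧ (x = cpt s' ∨ x = cpt t') := by
  suffices hz : x 2 = 0 from ⟨arcE_zero hh hε hx hz, arcE_zero hh' hε' hx' hz⟩
  by_contra hz
  obtain ⟨a1, -, a3, a4, a5, a6⟩ := arcE_facts hh hε hx
  obtain ⟨b1, -, b3, -, b5, b6⟩ := arcE_facts hh' hε' hx'
  have p := arcE_prod hh hε hx
  have p' := arcE_prod hh' hε' hx'
  have e1 : h = h' := by
    apply mul_right_cancel₀ hz; linarith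
  have e2 : ε = ε' := by
    rcases hε with rfl | rfl <;> rcases hε' with rfl | rfl
    · rfl
    · exact absurd (by linarith) hz
    · exact absurd (by linarith) hz
    · rfl
  subst e1
  set A := 1 + h * x 2 + x 0
  have hpos : 0 < x 2 ^ 2 * (1 + h ^ 2) := by positivity
  have u1 : 0 < x 1 - s * A := by
    refine lt_of_le_of_ne (by linarith) ?_
    intro h0; rw [← h0] at p; linarith
  have u2 : 0 < t * A - x 1 := by
    refine lt_of_le_of_ne (by linarith) ?_
    intro h0; rw [← h0] at p; linarith
  have v1 : 0 < x 1 - s' * A := by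
    refine lt_of_le_of_ne (by linarith) ?_
    intro h0; rw [← h0] at p'; linarith
  have v2 : 0 < t' * A - x 1 := by
    refine lt_of_le_of_ne (by linarith) ?_
    intro h0; rw [← h0] at p'; linarith
  have w1 : s < t' := lt_of_mul_lt_mul_right (by linarith) a4.le
  have w2 : s' < t := lt_of_mul_lt_mul_right (by linarith) a4.le
  rcases hne rfl e2 w1 w2 with ⟨q1, q2⟩ | ⟨q1, q2⟩ | ⟨q1, q2⟩ | ⟨q1, q2⟩
  · have r1 : s * A ≤ s' * A := by gcongr
    have r2 : t' * A < t * A := by gcongr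
    nlinarith
  · have r1 : s * A < s' * A := by gcongr
    have r2 : t' * A ≤ t * A := by gcongr
    nlinarith
  · have r1 : s' * A ≤ s * A := by gcongr
    have r2 : t * A < t' * A := by gcongr
    nlinarith
  · have r1 : s' * A < s * A := by gcongr
    have r2 : t * A ≤ t' * A := by gcongr
    nlinarith

end SC

namespace SC
open Topology Filter

theorem page_nest {n i j i' j' : ℕ} (hij : i < j) (hjn : j < n) (hij' : i' < j') (hjn' : j' < n)
    (hp : ((i + j) % n) / 2 = ((i' + j') % n) / 2) : ¬ (i < i' ∧ i' < j ∧ j < j') := by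
  rintro ⟨h1, h2, h3⟩
  have hn : 0 < n := by omega
  have a1 := Nat.mod_lt (i + j) hn
  have b1 := Nat.mod_lt (i' + j') hn
  have key : ∀ a, a < 2 * n → a % n = a ∨ (a % n + n = a) := by
    intro a ha
    rcases lt_or_ge a n with h | h
    · left; exact Nat.mod_eq_of_lt h
    · right; rw [Nat.mod_eq_sub_mod h, Nat.mod_eq_of_lt (by omega)]; omega
  have c1 := key (i + j) (by omega)
  have c2 := key (i' + j') (by omega)
  omega

/-- Sphere index of an edge. -/
def hE {n : ℕ} (i j : Fin n) : ℝ := (((i.1 + j.1) % n / 4 : ℕ) : ℝ)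

/-- Side of an edge. -/
def sE {n : ℕ} (i j : Fin n) : ℝ := if ((i.1 + j.1) % n / 2) % 2 = 0 then 1 else -1

/-- The arc of an edge. -/
def aE {n : ℕ} (i j : Fin n) : Set E3 := arcE (hE i j) (sE i j) (i.1 : ℝ) (j.1 : ℝ)

theorem hE_nonneg {n : ℕ} (i j : Fin n) : 0 ≤ hE i j := Nat.cast_nonneg _

theorem sE_or {n : ℕ} (i j : Fin n) : sE i j = 1 ∨ sE i j = -1 := by
  unfold sE; split_ifs <;> simp

theorem aE_cross {n : ℕ} {i j i' j' : Fin n} (hij : i < j) (hij' : i' < j')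
    (hne : ¬ (i = i' ∧ j = j')) {x : E3} (hx : x ∈ aE i j) (hx' : x ∈ aE i' j') :
    (x = cpt (i.1 : ℝ) ∨ x = cpt (j.1 : ℝ)) ∧ (x = cpt (i'.1 : ℝ) ∨ x = cpt (j'.1 : ℝ)) := by
  refine arcE_cross (hE_nonneg i j) (sE_or i j) (hE_nonneg i' j') (sE_or i' j') ?_ hx hx'
  intro e1 e2 w1 w2
  have e1' : (i.1 + j.1) % n / 4 = (i'.1 + j'.1) % n / 4 := by
    unfold hE at e1; exact_mod_cast e1
  have e2' : ((i.1 + j.1) % n / 2) % 2 = ((i'.1 + j'.1) % n / 2) % 2 := by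
    unfold sE at e2
    split_ifs at e2 with g1 g2 g2
    · omega
    · norm_num at e2
    · norm_num at e2
    · omega
  have ep : (i.1 + j.1) % n / 2 = (i'.1 + j'.1) % n / 2 := by omega
  have n1 := page_nest (show i.1 < j.1 from hij) j.2 (show i'.1 < j'.1 from hij') j'.2 ep
  have n2 := page_nest (show i'.1 < j'.1 from hij') j'.2 (show i.1 < j.1 from hij) j.2 ep.symm
  rw [Fin.ext_iff, Fin.ext_iff] at hne
  norm_cast at w1 w2 ⊢
  omega

theorem edge_cases {n : ℕ} {e : Sym2 (Fin n)} (he : e ∈ (⊤ : SimpleGraph (Fin n)).edgeSet) :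
    ∃ i j : Fin n, i < j ∧ e = s(i, j) ∧ e.inf = i ∧ e.sup = j := by
  induction e using Sym2.ind with
  | _ x y =>
    have hxy : x ≠ y := by simpa using he
    rcases lt_or_gt_of_ne hxy with h | h
    · exact ⟨x, y, h, rfl, by simpa using h.le, by simpa using h.le⟩
    · exact ⟨y, x, h, Sym2.eq_swap, by simpa using h.le, by simpa using h.le⟩

/-- The upper bound drawing. -/
def drawing (n : ℕ) : CircularArcDrawing 3 (⊤ : SimpleGraph (Fin n)) where
  pos := fun v => cpt (v.1 : ℝ)
  inj := by
    intro u v h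
    exact Fin.ext (by exact_mod_cast cpt_inj h)
  arc := fun e => aE e.inf e.sup
  arc_isArc := by
    intro e he
    obtain ⟨i, j, hij, -, h1, h2⟩ := edge_cases he
    rw [h1, h2]
    exact isArc_arcE (hE_nonneg i j) (sE_or i j) (by exact_mod_cast hij)
  endpoint_mem := by
    intro e he v hv
    obtain ⟨i, j, hij, h0, h1, h2⟩ := edge_cases he
    have hij' : (i.1 : ℝ) ≤ (j.1 : ℝ) := by exact_mod_cast hij.le
    rw [h1, h2]
    rw [h0, Sym2.mem_iff] at hv
    rcases hv with rfl | rfl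
    · exact cpt_left_mem hij'
    · exact cpt_right_mem hij'
  crossFree := by
    intro e he f hf hef
    obtain ⟨i, j, hij, h0, h1, h2⟩ := edge_cases he
    obtain ⟨i', j', hij', h0', h1', h2'⟩ := edge_cases hf
    have hijr : (i.1 : ℝ) ≤ (j.1 : ℝ) := by exact_mod_cast hij.le
    have hijr' : (i'.1 : ℝ) ≤ (j'.1 : ℝ) := by exact_mod_cast hij'.le
    rw [h1, h2, h1', h2']
    have hc : ∀ u v : Fin n, cpt (u.1 : ℝ) = cpt (v.1 : ℝ) → u = v := fun u v h =>
      Fin.ext (by exact_mod_cast cpt_inj h)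
    apply Subset.antisymm
    · rintro x ⟨hx, hx'⟩
      have hne : ¬ (i = i' ∧ j = j') := by
        rintro ⟨rfl, rfl⟩; exact hef (h0.trans h0'.symm)
      obtain ⟨r1, r2⟩ := aE_cross hij hij' hne hx hx'
      have m1 : ∃ u, u ∈ e ∧ x = cpt (u.1 : ℝ) := by
        rw [h0]
        rcases r1 with h | h
        · exact ⟨i, by simp, h⟩
        · exact ⟨j, by simp, h⟩
      have m2 : ∃ u, u ∈ f ∧ x = cpt (u.1 : ℝ) := by
        rw [h0']
        rcases r2 with h | h
        · exact ⟨i', by simp, h⟩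
        · exact ⟨j', by simp, h⟩
      obtain ⟨u, hu, hxu⟩ := m1
      obtain ⟨v, hv, hxv⟩ := m2
      have : u = v := hc u v (hxu.symm.trans hxv)
      subst this
      exact ⟨u, ⟨hu, hv⟩, hxu.symm⟩
    · rintro _ ⟨w, ⟨hw, hw'⟩, rfl⟩
      rw [h0, Sym2.mem_iff] at hw
      rw [h0', Sym2.mem_iff] at hw'
      constructor
      · rcases hw with rfl | rfl
        · exact cpt_left_mem hijr
        · exact cpt_right_mem hijr
      · rcases hw' with rfl | rfl
        · exact cpt_left_mem hijr'
        · exact cpt_right_mem hijr'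
  vertex_mem := by
    intro e he w hw
    obtain ⟨i, j, hij, h0, h1, h2⟩ := edge_cases he
    rw [h1, h2] at hw
    rw [h0, Sym2.mem_iff]
    have hc : ∀ u v : Fin n, cpt (u.1 : ℝ) = cpt (v.1 : ℝ) → u = v := fun u v h =>
      Fin.ext (by exact_mod_cast cpt_inj h)
    rcases arcE_zero (hE_nonneg i j) (sE_or i j) hw (by simp [cpt]) with h | h
    · left; exact hc _ _ h
    · right; exact hc _ _ h

theorem upper {n : ℕ} (hn : 3 ≤ n) : ∃ (D : CircularArcDrawing 3 (⊤ : SimpleGraph (Fin n)))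
    (𝒮 : Finset (Set (EuclideanSpace ℝ (Fin 3)))),
    D.ArcsInSpheres 𝒮 ∧ 𝒮.card ≤ (n + 3) / 4 := by
  classical
  refine ⟨drawing n, (Finset.range ((n + 3) / 4)).image fun k : ℕ => sph (k : ℝ), ⟨?_, ?_⟩, ?_⟩
  · intro S hS
    obtain ⟨k, -, rfl⟩ := Finset.mem_image.1 hS
    exact isSphere_sph _
  · intro e he x hx
    obtain ⟨i, j, hij, h0, h1, h2⟩ := edge_cases he
    change x ∈ aE e.inf e.sup at hx
    rw [h1, h2] at hx
    refine mem_iUnion₂.2 ⟨sph (hE i j), Finset.mem_image.2 ⟨(i.1 + j.1) % n / 4, ?_, rfl⟩, ?_⟩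
    · have := Nat.mod_lt (i.1 + j.1) (show 0 < n by omega)
      rw [Finset.mem_range]; omega
    · exact mem_sph.2 (arcE_facts (hE_nonneg i j) (sE_or i j) hx).1
  · exact Finset.card_image_le.trans (by simp)

end SC

/-- For every `n ≥ 3`, the spherical cover number `σ²₃(K_n)` satisfies
`⌊(n+7)/6⌋ ≤ σ²₃(K_n) ≤ ⌈n/4⌉`: the complete graph `K_n` admits a crossing-free
circular-arc drawing in `ℝ³` whose arcs are contained in the union of at most `⌈n/4⌉`
spheres, and no crossing-free circular-arc drawing of `K_n` in `ℝ³` is contained in the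
union of fewer than `⌊(n+7)/6⌋` spheres. -/
theorem sphere_cover_completeGraph (n : ℕ) (hn : 3 ≤ n) :
    (∃ (D : CircularArcDrawing 3 (⊤ : SimpleGraph (Fin n)))
        (𝒮 : Finset (Set (EuclideanSpace ℝ (Fin 3)))),
        D.ArcsInSpheres 𝒮 ∧ 𝒮.card ≤ (n + 3) / 4) ∧
    (∀ (D : CircularArcDrawing 3 (⊤ : SimpleGraph (Fin n)))
        (𝒮 : Finset (Set (EuclideanSpace ℝ (Fin 3)))),
        D.ArcsInSpheres 𝒮 → (n + 7) / 6 ≤ 𝒮.card) := by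
  exact ⟨SC.upper hn, fun D 𝒮 h => SC.lower hn D 𝒮 h⟩
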